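/- arXiv:1501.06038 — 2 statements merged into one kernel-verified Lean document; each statement's English description precedes it below -/
import Mathlib

section
/- For all n ≥ 1, reg R/(I+J)^n ≤ max_{i ∈ [1,n−1], j ∈ [1,n]} { reg A/I^{n−i} + reg B/J^i + 1 , reg A/I^{n−j+1} + reg B/J^j }, where the maximum is taken over both families of expressions (the first family being empty when n = 1). -/
/-! Core definitions: depth via local cohomology at the maximal homogeneous ideal,
Castelnuovo–Mumford regularity via graded free resolutions, gradings on
subquotients of polynomial rings.  -/

open MvPolynomial

noncomputable section

namespace PaperHTT

variable (k : Type) [Field k]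

/-- A polynomial is homogeneous of degree `e : ℤ` (it must vanish in negative degrees). -/
def homogZ {σ : Type} (p : MvPolynomial σ k) (e : ℤ) : Prop :=
  p = 0 ∨ (0 ≤ e ∧ p.IsHomogeneous e.toNat)

/-- The maximal homogeneous ideal `(x_1, …, x_r)` of a polynomial ring. -/
def maxHomIdeal (σ : Type) : Ideal (MvPolynomial σ k) :=
  Ideal.span (Set.range MvPolynomial.X)

/-- The depth of a module over a polynomial ring with respect to the maximal homogeneous
ideal: the least `i` such that the `i`-th local cohomology is non-vanishing. -/
def depthM {σ : Type} (M : ModuleCat (MvPolynomial σ k)) : ℕ :=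
  sInf {i : ℕ | Nontrivial ((localCohomology (maxHomIdeal k σ) i).obj M)}

/-- The subquotient `p/q` of a polynomial ring, for ideals `q ≤ p`. -/
abbrev subQuot {σ : Type} (p q : Ideal (MvPolynomial σ k)) : Type :=
  ↥p ⧸ (Submodule.comap p.subtype q)

/-- The degree-`t` graded piece of `p/q`: the image of the homogeneous elements of
degree `t` of `p`. -/
def subQuotGr {σ : Type} (p q : Ideal (MvPolynomial σ k)) (t : ℤ) :
    AddSubgroup (subQuot k p q) :=
  AddSubgroup.closure
    {x | ∃ f : p, homogZ k (f : MvPolynomial σ k) t ∧ x = Submodule.Quotient.mk f}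

/-- The degree-`t` graded piece of the quotient ring `P/Q`. -/
def quotGr {σ : Type} (Q : Ideal (MvPolynomial σ k)) (t : ℤ) :
    AddSubgroup (MvPolynomial σ k ⧸ Q) :=
  AddSubgroup.closure {x | ∃ f, homogZ k f t ∧ x = Ideal.Quotient.mk Q f}

/-- The degree-`t` graded piece of an ideal `p`, viewed as a module. -/
def idealGr {σ : Type} (p : Ideal (MvPolynomial σ k)) (t : ℤ) : AddSubgroup ↥p :=
  AddSubgroup.closure {x : p | homogZ k (x : MvPolynomial σ k) t}

/-- A finite graded free resolution of a module `M` over a polynomial ring,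
with respect to a grading `gr` of `M`: `F_i` is free of rank `rk i`, with basis elements
of (twisted) degrees `tw i l`, the differentials and augmentation are graded of degree `0`,
and the complex `⋯ → F_1 → F_0 → M → 0` is exact. -/
structure GradedFreeRes (σ : Type) (M : Type) [AddCommGroup M]
    [Module (MvPolynomial σ k) M] (gr : ℤ → AddSubgroup M) where
  rk : ℕ → ℕ
  tw : (i : ℕ) → Fin (rk i) → ℤ
  bdd : ∃ N, ∀ i, N ≤ i → rk i = 0
  aug : (Fin (rk 0) → MvPolynomial σ k) →ₗ[MvPolynomial σ k] M
  d : (i : ℕ) →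
    ((Fin (rk (i + 1)) → MvPolynomial σ k) →ₗ[MvPolynomial σ k]
      (Fin (rk i) → MvPolynomial σ k))
  aug_surj : Function.Surjective aug
  exact_zero : LinearMap.range (d 0) = LinearMap.ker aug
  exact_succ : ∀ i, LinearMap.range (d (i + 1)) = LinearMap.ker (d i)
  aug_homog : ∀ l, aug (Pi.single l 1) ∈ gr (tw 0 l)
  d_homog : ∀ i l l', homogZ k (d i (Pi.single l 1) l') (tw (i + 1) l - tw i l')

/-- The Castelnuovo–Mumford regularity of a (finitely generated) graded module over a
polynomial ring: the least `r` such that `M` admits a graded free resolution with all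
twists in homological degree `i` at most `r + i`.  (By minimal free resolutions, this
agrees with `max {aⁱ(M) + i}`.) -/
def regM (σ : Type) (M : Type) [AddCommGroup M] [Module (MvPolynomial σ k) M]
    (gr : ℤ → AddSubgroup M) : ℤ :=
  sInf {r : ℤ | ∃ F : GradedFreeRes k σ M gr, ∀ i (l : Fin (F.rk i)), F.tw i l - (i : ℤ) ≤ r}

/-- Depth of the quotient ring `P/Q` as a module over `P`. -/
def depthQuot {σ : Type} (Q : Ideal (MvPolynomial σ k)) : ℕ :=
  depthM k (ModuleCat.of (MvPolynomial σ k) (MvPolynomial σ k ⧸ Q))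

/-- Depth of the subquotient `p/q` as a module over the polynomial ring. -/
def depthSubQuot {σ : Type} (p q : Ideal (MvPolynomial σ k)) : ℕ :=
  depthM k (ModuleCat.of (MvPolynomial σ k) (subQuot k p q))

/-- Depth of an ideal `p` as a module over the polynomial ring. -/
def depthIdeal {σ : Type} (p : Ideal (MvPolynomial σ k)) : ℕ :=
  depthM k (ModuleCat.of (MvPolynomial σ k) ↥p)

/-- Regularity of the quotient ring `P/Q`. -/
def regQuot {σ : Type} (Q : Ideal (MvPolynomial σ k)) : ℤ :=
  regM k σ (MvPolynomial σ k ⧸ Q) (quotGr k Q)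

/-- Regularity of the subquotient `p/q`. -/
def regSubQuot {σ : Type} (p q : Ideal (MvPolynomial σ k)) : ℤ :=
  regM k σ (subQuot k p q) (subQuotGr k p q)

/-- Regularity of an ideal `p`, viewed as a graded module. -/
def regIdeal {σ : Type} (p : Ideal (MvPolynomial σ k)) : ℤ :=
  regM k σ (↥p) (idealGr k p)

/-- A homogeneous ideal: one containing all homogeneous components of its elements. -/
def IsHomogeneousIdeal {σ : Type} (I : Ideal (MvPolynomial σ k)) : Prop :=
  ∀ f ∈ I, ∀ m : ℕ, MvPolynomial.homogeneousComponent m f ∈ I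

/-- A monomial ideal. -/
def IsMonomialIdeal {σ : Type} (I : Ideal (MvPolynomial σ k)) : Prop :=
  ∃ S : Set (σ →₀ ℕ), I = Ideal.span ((fun a => MvPolynomial.monomial a (1 : k)) '' S)

/-- A squarefree monomial ideal. -/
def IsSquarefreeMonomialIdeal {σ : Type} (I : Ideal (MvPolynomial σ k)) : Prop :=
  ∃ S : Set (σ →₀ ℕ), (∀ a ∈ S, ∀ x, a x ≤ 1) ∧
    I = Ideal.span ((fun a => MvPolynomial.monomial a (1 : k)) '' S)


/-- The quotient ring `P/Q` is Cohen–Macaulay: its depth equals its Krull dimension. -/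
def IsCMQuot {σ : Type} (Q : Ideal (MvPolynomial σ k)) : Prop :=
  (depthQuot k Q : WithBot (WithTop ℕ)) = ringKrullDim (MvPolynomial σ k ⧸ Q)

/-- An isomorphism of graded modules: a linear isomorphism matching up the gradings. -/
def GradedIso {P : Type} [CommRing P] {M N : Type} [AddCommGroup M] [Module P M]
    [AddCommGroup N] [Module P N] (grM : ℤ → AddSubgroup M) (grN : ℤ → AddSubgroup N) :
    Prop :=
  ∃ e : M ≃ₗ[P] N, ∀ t, (grM t).map e.toLinearMap.toAddMonoidHom = grN t

/-- `gr` is an (internal, ℤ-) grading of the module `M` over a polynomial ring,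
compatible with the standard grading of the polynomial ring. -/
def IsGrading (σ : Type) {M : Type} [AddCommGroup M] [Module (MvPolynomial σ k) M]
    (gr : ℤ → AddSubgroup M) : Prop :=
  DirectSum.IsInternal (fun t : ℤ => gr t) ∧
    ∀ (p : MvPolynomial σ k) (d : ℕ) (t : ℤ) (m : M), p.IsHomogeneous d → m ∈ gr t →
      p • m ∈ gr (t + d)

/-- The polynomial ring `A = k[x_1,…,x_r]`. -/
abbrev PA (r : ℕ) : Type := MvPolynomial (Fin r) k

/-- The polynomial ring `B = k[y_1,…,y_s]`. -/
abbrev PB (s : ℕ) : Type := MvPolynomial (Fin s) k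

/-- The polynomial ring `R = k[x_1,…,x_r,y_1,…,y_s]`. -/
abbrev PR (r s : ℕ) : Type := MvPolynomial (Fin r ⊕ Fin s) k

/-- The extension of an ideal `I ⊆ A` to `R`. -/
def extA {r s : ℕ} (I : Ideal (PA k r)) : Ideal (PR k r s) :=
  I.map (MvPolynomial.rename (Sum.inl : Fin r → Fin r ⊕ Fin s))

/-- The extension of an ideal `J ⊆ B` to `R`. -/
def extB {r s : ℕ} (J : Ideal (PB k s)) : Ideal (PR k r s) :=
  J.map (MvPolynomial.rename (Sum.inr : Fin s → Fin r ⊕ Fin s))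

/-- The ideal `I + J ⊆ R`. -/
def sumIJ {r s : ℕ} (I : Ideal (PA k r)) (J : Ideal (PB k s)) : Ideal (PR k r s) :=
  extA k I + extB k J

end PaperHTT

end

namespace PaperHTT

variable {k : Type} [Field k] {σ : Type}

section Homogeneous

lemma homogZ.add {p q : MvPolynomial σ k} {e : ℤ} (hp : homogZ k p e) (hq : homogZ k q e) :
    homogZ k (p + q) e := by
  rcases hp with rfl | ⟨h, hp⟩
  · simpa using hq
  · rcases hq with rfl | ⟨_, hq⟩
    · exact Or.inr ⟨h, by simpa using hp⟩
    · exact Or.inr ⟨h, hp.add hq⟩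

lemma homogZ_zero (e : ℤ) : homogZ k (0 : MvPolynomial σ k) e := Or.inl rfl

lemma homogZ_one : homogZ k (1 : MvPolynomial σ k) 0 := Or.inr ⟨le_rfl, isHomogeneous_one σ k⟩

lemma homogZ.neg {p : MvPolynomial σ k} {e : ℤ} (hp : homogZ k p e) : homogZ k (-p) e := by
  rcases hp with rfl | ⟨h, hp⟩
  · simpa using homogZ_zero e
  · exact Or.inr ⟨h, hp.neg⟩

lemma homogZ.mul {p q : MvPolynomial σ k} {e e' : ℤ} (hp : homogZ k p e) (hq : homogZ k q e') :
    homogZ k (p * q) (e + e') := by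
  rcases hp with rfl | ⟨h, hp⟩
  · simpa using homogZ_zero _
  · rcases hq with rfl | ⟨h', hq⟩
    · simpa using homogZ_zero _
    · refine Or.inr ⟨by lia, ?_⟩
      rw [Int.toNat_add h h']
      exact hp.mul hq

/-- The homogeneous component of integer degree `e`. -/
noncomputable def compZ (e : ℤ) : MvPolynomial σ k →ₗ[k] MvPolynomial σ k :=
  if 0 ≤ e then homogeneousComponent e.toNat else 0

lemma coeff_compZ (e : ℤ) (p : MvPolynomial σ k) (d : σ →₀ ℕ) :
    coeff d (compZ e p) = if (d.degree : ℤ) = e then coeff d p else 0 := by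
  unfold compZ
  split_ifs with h1 h2 h2
  · rw [coeff_homogeneousComponent, if_pos (by lia)]
  · rw [coeff_homogeneousComponent, if_neg (by lia)]
  · lia
  · simp

lemma homogZ_compZ (e : ℤ) (p : MvPolynomial σ k) : homogZ k (compZ e p) e := by
  unfold compZ
  split_ifs with h1
  · exact Or.inr ⟨h1, homogeneousComponent_isHomogeneous _ _⟩
  · exact Or.inl rfl

lemma homogZ.coeff_eq_zero {p : MvPolynomial σ k} {e : ℤ} (hp : homogZ k p e) {d : σ →₀ ℕ}
    (hd : (d.degree : ℤ) ≠ e) : coeff d p = 0 := by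
  rcases hp with rfl | ⟨h, hp⟩
  · simp
  · exact hp.coeff_eq_zero (by lia)

lemma homogZ.compZ_eq {p : MvPolynomial σ k} {e : ℤ} (hp : homogZ k p e) (e' : ℤ) :
    compZ e' p = if e = e' then p else 0 := by
  ext d
  rw [coeff_compZ]
  by_cases hd : (d.degree : ℤ) = e
  · subst hd
    split_ifs <;> simp
  · have := hp.coeff_eq_zero hd
    split_ifs <;> simp [this]

variable {ι ι' ι'' : Type}

/-- Homogeneity of degree `t` in the free module with twists `tw`. -/
def HomV (tw : ι → ℤ) (t : ℤ) (f : ι → MvPolynomial σ k) : Prop :=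
  ∀ l, homogZ k (f l) (t - tw l)

lemma HomV.add {tw : ι → ℤ} {t : ℤ} {f g : ι → MvPolynomial σ k} (hf : HomV tw t f)
    (hg : HomV tw t g) : HomV tw t (f + g) := fun l => (hf l).add (hg l)

lemma HomV.neg {tw : ι → ℤ} {t : ℤ} {f : ι → MvPolynomial σ k} (hf : HomV tw t f) :
    HomV tw t (-f) := fun l => (hf l).neg

lemma HomV_zero (tw : ι → ℤ) (t : ℤ) : HomV tw t (0 : ι → MvPolynomial σ k) :=
  fun _ => homogZ_zero _

lemma HomV.sum {α : Type*} (s : Finset α) {tw : ι → ℤ} {t : ℤ} {f : α → ι → MvPolynomial σ k}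
    (h : ∀ i ∈ s, HomV tw t (f i)) : HomV tw t (∑ i ∈ s, f i) :=
  Finset.sum_induction f (fun q => HomV tw t q) (fun _ _ => HomV.add) (HomV_zero _ _) h

lemma HomV.smul {tw : ι → ℤ} {t e : ℤ} {f : ι → MvPolynomial σ k} {p : MvPolynomial σ k}
    (hp : homogZ k p e) (hf : HomV tw t f) : HomV tw (e + t) (p • f) := fun l => by
  have := hp.mul (hf l)
  rw [← add_sub_assoc] at this
  exact this

lemma HomV_single [DecidableEq ι] (tw : ι → ℤ) (l : ι) :
    HomV tw (tw l) (Pi.single l (1 : MvPolynomial σ k)) := fun l' => by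
  by_cases h : l' = l
  · subst h
    simpa using homogZ_one
  · simpa [h] using homogZ_zero _

/-- The component of degree `t` in the free module with twists `tw`. -/
noncomputable def compV (tw : ι → ℤ) (t : ℤ) :
    (ι → MvPolynomial σ k) →ₗ[k] (ι → MvPolynomial σ k) :=
  LinearMap.pi fun l => compZ (t - tw l) ∘ₗ LinearMap.proj l

@[simp] lemma compV_apply (tw : ι → ℤ) (t : ℤ) (f : ι → MvPolynomial σ k) (l : ι) :
    compV tw t f l = compZ (t - tw l) (f l) := rfl

lemma HomV_compV (tw : ι → ℤ) (t : ℤ) (f : ι → MvPolynomial σ k) : HomV tw t (compV tw t f) :=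
  fun _ => homogZ_compZ _ _

lemma HomV.compV_eq {tw : ι → ℤ} {t : ℤ} {f : ι → MvPolynomial σ k} (hf : HomV tw t f) (t' : ℤ) :
    compV tw t' f = if t = t' then f else 0 := by
  ext1 l
  rw [compV_apply, (hf l).compZ_eq]
  by_cases h : t = t' <;> simp [h]

lemma exists_sum_compV [Finite ι] (tw : ι → ℤ) (f : ι → MvPolynomial σ k) :
    ∃ S : Finset ℤ, ∑ t ∈ S, compV tw t f = f := by
  classical
  have := Fintype.ofFinite ι
  refine ⟨Finset.univ.biUnion fun l => (f l).support.image fun d => (d.degree : ℤ) + tw l, ?_⟩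
  ext l d
  simp only [Finset.sum_apply, compV_apply, coeff_sum, coeff_compZ]
  by_cases hd : coeff d (f l) = 0
  · simp [hd]
  · rw [Finset.sum_eq_single ((d.degree : ℤ) + tw l)]
    · simp
    · intro t _ ht
      rw [if_neg (by lia)]
    · intro h
      exact absurd (Finset.mem_biUnion.2 ⟨l, Finset.mem_univ _,
        Finset.mem_image_of_mem _ (mem_support_iff.2 hd)⟩) h

/-- Graded linear maps of degree zero between twisted free modules. -/
def GrMap (tw : ι → ℤ) (tw' : ι' → ℤ)
    (φ : (ι → MvPolynomial σ k) →ₗ[MvPolynomial σ k] (ι' → MvPolynomial σ k)) : Prop :=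
  ∀ t f, HomV tw t f → HomV tw' t (φ f)

lemma GrMap.comp {tw : ι → ℤ} {tw' : ι' → ℤ} {tw'' : ι'' → ℤ}
    {φ : (ι → MvPolynomial σ k) →ₗ[MvPolynomial σ k] (ι' → MvPolynomial σ k)}
    {ψ : (ι' → MvPolynomial σ k) →ₗ[MvPolynomial σ k] (ι'' → MvPolynomial σ k)}
    (hψ : GrMap tw' tw'' ψ) (hφ : GrMap tw tw' φ) : GrMap tw tw'' (ψ ∘ₗ φ) :=
  fun t f hf => hψ t _ (hφ t f hf)

lemma GrMap.add {tw : ι → ℤ} {tw' : ι' → ℤ}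
    {φ ψ : (ι → MvPolynomial σ k) →ₗ[MvPolynomial σ k] (ι' → MvPolynomial σ k)}
    (hφ : GrMap tw tw' φ) (hψ : GrMap tw tw' ψ) : GrMap tw tw' (φ + ψ) :=
  fun t f hf => (hφ t f hf).add (hψ t f hf)

lemma GrMap.map_compV [Finite ι] {tw : ι → ℤ} {tw' : ι' → ℤ}
    {φ : (ι → MvPolynomial σ k) →ₗ[MvPolynomial σ k] (ι' → MvPolynomial σ k)}
    (hφ : GrMap tw tw' φ) (t : ℤ) (f : ι → MvPolynomial σ k) :
    φ (compV tw t f) = compV tw' t (φ f) := by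
  obtain ⟨S, hS⟩ := exists_sum_compV tw f
  conv_lhs => rw [← hS]
  conv_rhs => rw [← hS]
  simp only [map_sum]
  refine Finset.sum_congr rfl fun s _ => ?_
  rw [(HomV_compV tw s f).compV_eq t, (hφ s _ (HomV_compV tw s f)).compV_eq t]
  split_ifs <;> simp

lemma grMap_of_single [Fintype ι] [DecidableEq ι] {tw : ι → ℤ} {tw' : ι' → ℤ}
    {φ : (ι → MvPolynomial σ k) →ₗ[MvPolynomial σ k] (ι' → MvPolynomial σ k)}
    (h : ∀ l, HomV tw' (tw l) (φ (Pi.single l 1))) : GrMap tw tw' φ := by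
  intro t f hf
  rw [pi_eq_sum_univ' f, map_sum]
  refine HomV.sum _ fun l _ => ?_
  have := HomV.smul (hf l) (h l)
  rw [sub_add_cancel, ← map_smul] at this
  convert this using 2

/-- Submodules of a twisted free module that are stable under taking components. -/
def HomSub (tw : ι → ℤ) (K : Submodule (MvPolynomial σ k) (ι → MvPolynomial σ k)) : Prop :=
  ∀ f ∈ K, ∀ t, compV tw t f ∈ K

lemma HomSub.comap [Finite ι] {tw : ι → ℤ} {tw' : ι' → ℤ}
    {φ : (ι → MvPolynomial σ k) →ₗ[MvPolynomial σ k] (ι' → MvPolynomial σ k)}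
    (hφ : GrMap tw tw' φ) {K : Submodule (MvPolynomial σ k) (ι' → MvPolynomial σ k)}
    (hK : HomSub tw' K) : HomSub tw (K.comap φ) := fun f hf t => by
  rw [Submodule.mem_comap, hφ.map_compV]
  exact hK _ hf t

lemma homSub_bot (tw : ι → ℤ) :
    HomSub tw (⊥ : Submodule (MvPolynomial σ k) (ι → MvPolynomial σ k)) := fun f hf t => by
  rw [Submodule.mem_bot] at hf ⊢
  rw [hf, map_zero]

lemma homSub_ker [Finite ι] {tw : ι → ℤ} {tw' : ι' → ℤ}
    {φ : (ι → MvPolynomial σ k) →ₗ[MvPolynomial σ k] (ι' → MvPolynomial σ k)}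
    (hφ : GrMap tw tw' φ) : HomSub tw (LinearMap.ker φ) :=
  (homSub_bot tw').comap hφ

lemma homSub_range [Finite ι] {tw : ι → ℤ} {tw' : ι' → ℤ}
    {φ : (ι → MvPolynomial σ k) →ₗ[MvPolynomial σ k] (ι' → MvPolynomial σ k)}
    (hφ : GrMap tw tw' φ) : HomSub tw' (LinearMap.range φ) := by
  rintro _ ⟨f, rfl⟩ t
  exact ⟨compV tw t f, hφ.map_compV t f⟩

lemma HomSub.exists_lift [Finite ι] {tw : ι → ℤ} {tw' : ι' → ℤ}
    {φ : (ι → MvPolynomial σ k) →ₗ[MvPolynomial σ k] (ι' → MvPolynomial σ k)}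
    (hφ : GrMap tw tw' φ) {K : Submodule (MvPolynomial σ k) (ι → MvPolynomial σ k)}
    (hK : HomSub tw K) {t : ℤ} {y : ι' → MvPolynomial σ k} (hy : HomV tw' t y)
    (hyK : y ∈ K.map φ) : ∃ x ∈ K, HomV tw t x ∧ φ x = y := by
  obtain ⟨x, hx, rfl⟩ := hyK
  refine ⟨compV tw t x, hK x hx t, HomV_compV _ _ _, ?_⟩
  rw [hφ.map_compV, hy.compV_eq, if_pos rfl]

lemma grMap_linearCombination [Fintype ι] {tw : ι → ℤ} {tw' : ι' → ℤ}
    {v : ι → ι' → MvPolynomial σ k} (hv : ∀ l, HomV tw' (tw l) (v l)) :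
    GrMap tw tw' (Fintype.linearCombination (MvPolynomial σ k) v) := by
  classical
  refine grMap_of_single fun l => ?_
  rw [Fintype.linearCombination_apply_single, one_smul]
  exact hv l

/-- The inclusion of the left summand. -/
noncomputable def extInl : (ι → MvPolynomial σ k) →ₗ[MvPolynomial σ k] (ι ⊕ ι' → MvPolynomial σ k) where
  toFun f := Sum.elim f 0
  map_add' f g := by ext1 (l | l) <;> simp
  map_smul' c f := by ext1 (l | l) <;> simp

lemma grMap_extInl (tw : ι → ℤ) (tw' : ι' → ℤ) :
    GrMap tw (Sum.elim tw tw') (extInl (k := k) (σ := σ)) := by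
  rintro t f hf (l | l)
  · exact hf l
  · exact homogZ_zero _

lemma grMap_funLeft (tw : ι → ℤ) (g : ι' → ι) :
    GrMap tw (tw ∘ g) (LinearMap.funLeft (MvPolynomial σ k) (MvPolynomial σ k) g) :=
  fun _ _ hf l => hf (g l)

end Homogeneous

end PaperHTT

namespace PaperHTT

variable {k : Type} [Field k] {σ : Type}

section Regularity

variable {ι ι' ι'' : Type}

/-- `RegN N r tw K`: the submodule `K` of the free module with twists `tw` has a graded free
resolution of length less than `N` whose `i`-th twists are at most `r + i`. -/
def RegN : ℕ → ℤ → {ι : Type} → (ι → ℤ) →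
    Submodule (MvPolynomial σ k) (ι → MvPolynomial σ k) → Prop
  | 0, _, _, _, K => K = ⊥
  | N + 1, r, _, tw, K => ∃ (m : ℕ) (tw' : Fin m → ℤ)
      (φ : (Fin m → MvPolynomial σ k) →ₗ[MvPolynomial σ k] (_ → MvPolynomial σ k)),
      (∀ l, tw' l ≤ r) ∧ GrMap tw' tw φ ∧ LinearMap.range φ = K ∧
        RegN N (r + 1) tw' (LinearMap.ker φ)

lemma RegN.map {N : ℕ} {r : ℤ} {tw : ι → ℤ} {tw' : ι' → ℤ}
    {K : Submodule (MvPolynomial σ k) (ι → MvPolynomial σ k)} (h : RegN N r tw K)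
    {φ : (ι → MvPolynomial σ k) →ₗ[MvPolynomial σ k] (ι' → MvPolynomial σ k)}
    (hφ : GrMap tw tw' φ) (hK : ∀ x ∈ K, φ x = 0 → x = 0) : RegN N r tw' (K.map φ) := by
  cases N with
  | zero =>
    have h : K = ⊥ := h
    rw [h, Submodule.map_bot]
    rfl
  | succ N =>
    obtain ⟨m, tw'', ψ, h1, h2, rfl, h4⟩ := h
    refine ⟨m, tw'', φ ∘ₗ ψ, h1, hφ.comp h2, LinearMap.range_comp _ _, ?_⟩
    have : LinearMap.ker (φ ∘ₗ ψ) = LinearMap.ker ψ := by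
      ext x
      simp only [LinearMap.mem_ker, LinearMap.comp_apply]
      exact ⟨hK _ ⟨x, rfl⟩, fun h => by rw [h, map_zero]⟩
    rwa [this]

lemma RegN.intro [Fintype ι'] {N : ℕ} {r : ℤ} {tw : ι → ℤ} {tw' : ι' → ℤ}
    {φ : (ι' → MvPolynomial σ k) →ₗ[MvPolynomial σ k] (ι → MvPolynomial σ k)}
    (hr : ∀ l, tw' l ≤ r) (hφ : GrMap tw' tw φ) (h : RegN N (r + 1) tw' (LinearMap.ker φ)) :
    RegN (N + 1) r tw (LinearMap.range φ) := by
  let e := Fintype.equivFin ι'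
  have h1 : GrMap (tw' ∘ e.symm) tw'
      (LinearMap.funLeft (MvPolynomial σ k) (MvPolynomial σ k) e) := by
    have := grMap_funLeft (k := k) (σ := σ) (tw' ∘ e.symm) e
    rwa [Function.comp_assoc, Equiv.symm_comp_self, Function.comp_id] at this
  have h2 := grMap_funLeft (k := k) (σ := σ) tw' e.symm
  have hinv : ∀ x, LinearMap.funLeft (MvPolynomial σ k) (MvPolynomial σ k) e
      (LinearMap.funLeft (MvPolynomial σ k) (MvPolynomial σ k) e.symm x) = x := fun x => by
    ext1 l
    simp [LinearMap.funLeft_apply]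
  have hinv' : ∀ x, LinearMap.funLeft (MvPolynomial σ k) (MvPolynomial σ k) e.symm
      (LinearMap.funLeft (MvPolynomial σ k) (MvPolynomial σ k) e x) = x := fun x => by
    ext1 l
    simp [LinearMap.funLeft_apply]
  refine ⟨_, tw' ∘ e.symm, φ ∘ₗ LinearMap.funLeft _ _ e, fun l => hr _, hφ.comp h1, ?_, ?_⟩
  · rw [LinearMap.range_comp_of_range_eq_top]
    exact LinearMap.range_eq_top.2 fun x => ⟨_, hinv x⟩
  · convert h.map h2 fun x _ hx => ?_ using 1
    · ext x
      simp only [LinearMap.mem_ker, LinearMap.comp_apply, Submodule.mem_map]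
      exact ⟨fun h => ⟨_, h, hinv' x⟩, by rintro ⟨y, hy, rfl⟩; rwa [hinv]⟩
    · rw [← hinv x, hx, map_zero]

lemma RegN.succ {N : ℕ} {r : ℤ} {tw : ι → ℤ}
    {K : Submodule (MvPolynomial σ k) (ι → MvPolynomial σ k)} (h : RegN N r tw K) :
    RegN (N + 1) r tw K := by
  induction N generalizing r ι with
  | zero =>
    have h : K = ⊥ := h
    refine ⟨0, Fin.elim0, 0, fun l => l.elim0, fun t f _ => HomV_zero _ _, ?_, ?_⟩
    · rw [LinearMap.range_zero, h]
    · exact Subsingleton.elim _ _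
  | succ N ih =>
    obtain ⟨m, tw', φ, h1, h2, h3, h4⟩ := h
    exact ⟨m, tw', φ, h1, h2, h3, ih h4⟩

lemma RegN.mono {N N' : ℕ} {r r' : ℤ} {tw : ι → ℤ}
    {K : Submodule (MvPolynomial σ k) (ι → MvPolynomial σ k)} (h : RegN N r tw K)
    (hN : N ≤ N') (hr : r ≤ r') : RegN N' r' tw K := by
  have key : RegN N r' tw K := by
    clear hN
    induction N generalizing r r' ι with
    | zero => exact h
    | succ N ih =>
      obtain ⟨m, tw', φ, h1, h2, h3, h4⟩ := h
      exact ⟨m, tw', φ, fun l => (h1 l).trans hr, h2, h3, ih h4 (by lia)⟩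
  induction hN with
  | refl => exact key
  | step _ ih => exact ih.succ

lemma RegN.shift {N : ℕ} {r : ℤ} {tw : ι → ℤ}
    {K : Submodule (MvPolynomial σ k) (ι → MvPolynomial σ k)} (h : RegN N r tw K) (c : ℤ) :
    RegN N (r + c) (fun l => tw l + c) K := by
  induction N generalizing r ι with
  | zero => exact h
  | succ N ih =>
    obtain ⟨m, tw', φ, h1, h2, h3, h4⟩ := h
    refine ⟨m, fun l => tw' l + c, φ, fun l => by linarith [h1 l], fun t f hf l => ?_, h3, ?_⟩
    · have := h2 (t - c) f (fun l => by convert hf l using 1; ring) l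
      convert this using 1
      ring
    · convert ih h4 using 1
      ring

lemma RegN.homSub {N : ℕ} {r : ℤ} {tw : ι → ℤ}
    {K : Submodule (MvPolynomial σ k) (ι → MvPolynomial σ k)} (h : RegN N r tw K) :
    HomSub tw K := by
  cases N with
  | zero =>
    have h : K = ⊥ := h
    exact h ▸ homSub_bot tw
  | succ N =>
    obtain ⟨m, tw', φ, h1, h2, rfl, h4⟩ := h
    exact homSub_range h2

/-- The horseshoe lemma: bounds on a kernel and an image give a bound on the module. -/
lemma RegN.ext [Finite ι] {N : ℕ} {r : ℤ} {tw : ι → ℤ} {tw' : ι' → ℤ}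
    {K : Submodule (MvPolynomial σ k) (ι → MvPolynomial σ k)} (hK : HomSub tw K)
    {p : (ι → MvPolynomial σ k) →ₗ[MvPolynomial σ k] (ι' → MvPolynomial σ k)}
    (hp : GrMap tw tw' p) (h1 : RegN N r tw (K ⊓ LinearMap.ker p))
    (h2 : RegN N r tw' (K.map p)) : RegN N r tw K := by
  induction N generalizing r ι ι' with
  | zero =>
    have h1 : K ⊓ LinearMap.ker p = ⊥ := h1
    have h2 : K.map p = ⊥ := h2
    have h3 : K ≤ LinearMap.ker p := fun x hx =>
      (Submodule.mem_bot (MvPolynomial σ k)).1 (h2 ▸ Submodule.mem_map_of_mem hx)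
    rwa [inf_eq_left.2 h3] at h1
  | succ N ih =>
    obtain ⟨m, u, φ, hu, hφ, hφr, hφk⟩ := h1
    obtain ⟨m', u', φ', hu', hφ', hφr', hφk'⟩ := h2
    have lift : ∀ l, ∃ x ∈ K, HomV tw (u' l) x ∧ p x = φ' (Pi.single l 1) := fun l =>
      hK.exists_lift hp (hφ' _ _ (HomV_single _ _)) (hφr' ▸ ⟨_, rfl⟩)
    choose v hvK hvh hv using lift
    let ψ := Fintype.linearCombination (MvPolynomial σ k) v
    have hψ : GrMap u' tw ψ := grMap_linearCombination hvh
    have hpψ : p ∘ₗ ψ = φ' := by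
      refine LinearMap.pi_ext' fun l => LinearMap.ext_ring ?_
      simp [ψ, Fintype.linearCombination_apply_single, hv]
    have hψK : ∀ x, ψ x ∈ K := fun x => by
      rw [Fintype.linearCombination_apply]
      exact K.sum_mem fun i _ => K.smul_mem _ (hvK i)
    have hφK : ∀ x, φ x ∈ K ∧ p (φ x) = 0 := fun x => by
      have : φ x ∈ K ⊓ LinearMap.ker p := hφr ▸ ⟨x, rfl⟩
      exact this
    let π₁ := LinearMap.funLeft (MvPolynomial σ k) (MvPolynomial σ k)
      (Sum.inl : Fin m → Fin m ⊕ Fin m')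
    let π₂ := LinearMap.funLeft (MvPolynomial σ k) (MvPolynomial σ k)
      (Sum.inr : Fin m' → Fin m ⊕ Fin m')
    have hπ₁ : GrMap (Sum.elim u u') u π₁ := grMap_funLeft (Sum.elim u u') Sum.inl
    have hπ₂ : GrMap (Sum.elim u u') u' π₂ := grMap_funLeft (Sum.elim u u') Sum.inr
    let Φ := φ ∘ₗ π₁ + ψ ∘ₗ π₂
    have hΦ : GrMap (Sum.elim u u') tw Φ := (hφ.comp hπ₁).add (hψ.comp hπ₂)
    have hΦelim : ∀ a b, Φ (Sum.elim a b) = φ a + ψ b := fun a b => rfl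
    have hpΦ : ∀ x, p (Φ x) = φ' (π₂ x) := fun x => by
      rw [← hpψ]
      change p (φ (π₁ x) + ψ (π₂ x)) = _
      rw [map_add, (hφK _).2, zero_add]
      rfl
    have hrange : LinearMap.range Φ = K := by
      apply le_antisymm
      · rintro _ ⟨x, rfl⟩
        exact K.add_mem (hφK _).1 (hψK _)
      · intro x hx
        have : p x ∈ LinearMap.range φ' := hφr' ▸ ⟨x, hx, rfl⟩
        obtain ⟨b, hb⟩ := this
        have : x - ψ b ∈ LinearMap.range φ := by
          rw [hφr]
          refine ⟨K.sub_mem hx (hψK b), ?_⟩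
          change p (x - ψ b) = 0
          rw [map_sub, ← hb, ← hpψ]
          exact sub_self _
        obtain ⟨a, ha⟩ := this
        exact ⟨Sum.elim a b, by rw [hΦelim, ha]; abel⟩
    rw [← hrange]
    refine RegN.intro (tw' := Sum.elim u u') ?_ hΦ ?_
    · rintro (l | l)
      exacts [hu l, hu' l]
    · refine ih (homSub_ker hΦ) hπ₂ ?_ ?_
      · convert hφk.map (grMap_extInl u u') ?_ using 1
        · ext x
          simp only [Submodule.mem_inf, LinearMap.mem_ker, Submodule.mem_map]
          constructor
          · rintro ⟨h1, h2⟩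
            refine ⟨π₁ x, ?_, ?_⟩
            · have : Φ x = φ (π₁ x) + ψ (π₂ x) := rfl
              rw [h1, h2, map_zero, add_zero] at this
              exact this.symm
            · ext1 (l | l)
              · rfl
              · exact (congrFun h2 l).symm
          · rintro ⟨y, hy, rfl⟩
            refine ⟨?_, rfl⟩
            change Φ (Sum.elim y 0) = 0
            rw [hΦelim, hy, map_zero, add_zero]
        · intro x _ hx
          ext1 l
          exact congrFun hx (Sum.inl l)
      · convert hφk' using 1
        ext y
        simp only [LinearMap.mem_ker, Submodule.mem_map]
        constructor
        · rintro ⟨x, hx, rfl⟩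
          rw [← hpΦ, hx, map_zero]
        · intro hy
          have : -ψ y ∈ LinearMap.range φ := by
            rw [hφr]
            refine ⟨K.neg_mem (hψK y), ?_⟩
            change p (-ψ y) = 0
            rw [map_neg, neg_eq_zero, ← hy, ← hpψ]
            rfl
          obtain ⟨a, ha⟩ := this
          exact ⟨Sum.elim a y, by rw [hΦelim, ha, neg_add_cancel], rfl⟩

/-- A submodule of a twisted free module with a finite graded free resolution whose `i`-th
twists are at most `r + i`. -/
def Reg (r : ℤ) (tw : ι → ℤ) (K : Submodule (MvPolynomial σ k) (ι → MvPolynomial σ k)) : Prop :=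
  ∃ N, RegN N r tw K

lemma Reg.mono {r r' : ℤ} {tw : ι → ℤ}
    {K : Submodule (MvPolynomial σ k) (ι → MvPolynomial σ k)} (h : Reg r tw K) (hr : r ≤ r') :
    Reg r' tw K :=
  h.imp fun _ h => h.mono le_rfl hr

lemma Reg.homSub {r : ℤ} {tw : ι → ℤ}
    {K : Submodule (MvPolynomial σ k) (ι → MvPolynomial σ k)} (h : Reg r tw K) :
    HomSub tw K :=
  h.choose_spec.homSub

lemma Reg.map {r : ℤ} {tw : ι → ℤ} {tw' : ι' → ℤ}
    {K : Submodule (MvPolynomial σ k) (ι → MvPolynomial σ k)} (h : Reg r tw K)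
    {φ : (ι → MvPolynomial σ k) →ₗ[MvPolynomial σ k] (ι' → MvPolynomial σ k)}
    (hφ : GrMap tw tw' φ) (hK : ∀ x ∈ K, φ x = 0 → x = 0) : Reg r tw' (K.map φ) :=
  h.imp fun _ h => h.map hφ hK

lemma Reg.shift {r : ℤ} {tw : ι → ℤ}
    {K : Submodule (MvPolynomial σ k) (ι → MvPolynomial σ k)} (h : Reg r tw K) (c : ℤ) :
    Reg (r + c) (fun l => tw l + c) K :=
  h.imp fun _ h => h.shift c

lemma reg_bot (r : ℤ) (tw : ι → ℤ) :
    Reg r tw (⊥ : Submodule (MvPolynomial σ k) (ι → MvPolynomial σ k)) := ⟨0, rfl⟩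

lemma reg_top [Fintype ι] {r : ℤ} {tw : ι → ℤ} (h : ∀ l, tw l ≤ r) :
    Reg r tw (⊤ : Submodule (MvPolynomial σ k) (ι → MvPolynomial σ k)) := by
  refine ⟨1, ?_⟩
  rw [← LinearMap.range_id]
  exact RegN.intro h (fun _ _ hf => hf) LinearMap.ker_id

lemma Reg.ext [Finite ι] {r : ℤ} {tw : ι → ℤ} {tw' : ι' → ℤ}
    {K : Submodule (MvPolynomial σ k) (ι → MvPolynomial σ k)} (hK : HomSub tw K)
    {p : (ι → MvPolynomial σ k) →ₗ[MvPolynomial σ k] (ι' → MvPolynomial σ k)}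
    (hp : GrMap tw tw' p) (h1 : Reg r tw (K ⊓ LinearMap.ker p))
    (h2 : Reg r tw' (K.map p)) : Reg r tw K := by
  obtain ⟨N₁, h1⟩ := h1
  obtain ⟨N₂, h2⟩ := h2
  exact ⟨max N₁ N₂, RegN.ext hK hp (h1.mono (le_max_left _ _) le_rfl)
    (h2.mono (le_max_right _ _) le_rfl)⟩

/-- Bounds on a module and on the kernel of a graded map give a bound on the image. -/
lemma Reg.image {r : ℤ} {tw : ι → ℤ} {tw' : ι' → ℤ}
    {K : Submodule (MvPolynomial σ k) (ι → MvPolynomial σ k)}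
    {p : (ι → MvPolynomial σ k) →ₗ[MvPolynomial σ k] (ι' → MvPolynomial σ k)}
    (hp : GrMap tw tw' p) (h1 : Reg (r + 1) tw (K ⊓ LinearMap.ker p))
    (h2 : Reg r tw K) : Reg r tw' (K.map p) := by
  obtain ⟨N, h2⟩ := h2
  obtain ⟨m, u, φ, hu, hφ, rfl, hφk⟩ := h2.succ
  have h3 : Reg (r + 1) u (LinearMap.ker (p ∘ₗ φ)) := by
    refine Reg.ext (homSub_ker (hp.comp hφ)) hφ ?_ ?_
    · rw [inf_eq_right.2 (LinearMap.ker_le_ker_comp φ p)]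
      exact ⟨N, hφk⟩
    · convert h1 using 1
      ext x
      simp only [Submodule.mem_map, LinearMap.mem_ker, Submodule.mem_inf, LinearMap.mem_range,
        LinearMap.comp_apply]
      constructor
      · rintro ⟨y, hy, rfl⟩
        exact ⟨⟨y, rfl⟩, hy⟩
      · rintro ⟨⟨y, rfl⟩, hy⟩
        exact ⟨y, hy, rfl⟩
  obtain ⟨N', h3⟩ := h3
  exact ⟨N' + 1, m, u, p ∘ₗ φ, hu, hp.comp hφ, LinearMap.range_comp _ _, h3⟩

end Regularity

end PaperHTT

namespace PaperHTT

variable {k : Type} [Field k] {σ : Type}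

section Constructions

variable {ι ι' : Type}

lemma GrMap.neg {tw : ι → ℤ} {tw' : ι' → ℤ}
    {φ : (ι → MvPolynomial σ k) →ₗ[MvPolynomial σ k] (ι' → MvPolynomial σ k)}
    (hφ : GrMap tw tw' φ) : GrMap tw tw' (-φ) :=
  fun t f hf => (hφ t f hf).neg

lemma HomSub.inf {tw : ι → ℤ} {K L : Submodule (MvPolynomial σ k) (ι → MvPolynomial σ k)}
    (hK : HomSub tw K) (hL : HomSub tw L) : HomSub tw (K ⊓ L) :=
  fun f hf t => ⟨hK f hf.1 t, hL f hf.2 t⟩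

/-- The pair of graded maps `φ`, `ψ` as a map into the direct sum. -/
noncomputable def pairMap {κ : Type}
    (φ : (κ → MvPolynomial σ k) →ₗ[MvPolynomial σ k] (ι → MvPolynomial σ k))
    (ψ : (κ → MvPolynomial σ k) →ₗ[MvPolynomial σ k] (ι' → MvPolynomial σ k)) :
    (κ → MvPolynomial σ k) →ₗ[MvPolynomial σ k] (ι ⊕ ι' → MvPolynomial σ k) where
  toFun f := Sum.elim (φ f) (ψ f)
  map_add' f g := by ext1 (l | l) <;> simp
  map_smul' c f := by ext1 (l | l) <;> simp

lemma GrMap.pairMap {κ : Type} {u : κ → ℤ} {tw : ι → ℤ} {tw' : ι' → ℤ}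
    {φ : (κ → MvPolynomial σ k) →ₗ[MvPolynomial σ k] (ι → MvPolynomial σ k)}
    {ψ : (κ → MvPolynomial σ k) →ₗ[MvPolynomial σ k] (ι' → MvPolynomial σ k)}
    (hφ : GrMap u tw φ) (hψ : GrMap u tw' ψ) :
    GrMap u (Sum.elim tw tw') (pairMap φ ψ) := by
  rintro t f hf (l | l)
  exacts [hφ t f hf l, hψ t f hf l]

/-- The projection to the left summand. -/
noncomputable abbrev prL : (ι ⊕ ι' → MvPolynomial σ k) →ₗ[MvPolynomial σ k]
    (ι → MvPolynomial σ k) := LinearMap.funLeft _ _ Sum.inl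

/-- The projection to the right summand. -/
noncomputable abbrev prR : (ι ⊕ ι' → MvPolynomial σ k) →ₗ[MvPolynomial σ k]
    (ι' → MvPolynomial σ k) := LinearMap.funLeft _ _ Sum.inr

lemma grMap_prL (tw : ι → ℤ) (tw' : ι' → ℤ) :
    GrMap (Sum.elim tw tw') tw (prL (k := k) (σ := σ)) := grMap_funLeft (Sum.elim tw tw') Sum.inl

lemma grMap_prR (tw : ι → ℤ) (tw' : ι' → ℤ) :
    GrMap (Sum.elim tw tw') tw' (prR (k := k) (σ := σ)) := grMap_funLeft (Sum.elim tw tw') Sum.inr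

lemma Reg.extInl {r : ℤ} {tw : ι → ℤ} (tw' : ι' → ℤ)
    {K : Submodule (MvPolynomial σ k) (ι → MvPolynomial σ k)} (h : Reg r tw K) :
    Reg r (Sum.elim tw tw') (K.map PaperHTT.extInl) :=
  h.map (grMap_extInl tw tw') fun x _ hx => by
    ext1 l
    exact congrFun hx (Sum.inl l)

lemma inf_ker_prR (K : Submodule (MvPolynomial σ k) (ι ⊕ ι' → MvPolynomial σ k))
    (L : Submodule (MvPolynomial σ k) (ι → MvPolynomial σ k))
    (h : ∀ x, (Sum.elim x 0 : ι ⊕ ι' → MvPolynomial σ k) ∈ K ↔ x ∈ L) :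
    K ⊓ LinearMap.ker prR = L.map extInl := by
  ext x
  simp only [Submodule.mem_inf, Submodule.mem_map, LinearMap.mem_ker]
  constructor
  · rintro ⟨h1, h2⟩
    have hx : Sum.elim (prL x) 0 = x := by
      ext1 (l | l)
      · rfl
      · exact (congrFun h2 l).symm
    exact ⟨prL x, (h _).1 (hx ▸ h1), hx⟩
  · rintro ⟨y, hy, rfl⟩
    exact ⟨(h y).2 hy, rfl⟩

/-- The sum of two submodules is controlled by the summands and their intersection. -/
lemma Reg.sup [Finite ι] {r : ℤ} {tw : ι → ℤ}
    {X Y : Submodule (MvPolynomial σ k) (ι → MvPolynomial σ k)} (hX : Reg r tw X)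
    (hY : Reg r tw Y) (hXY : Reg (r + 1) tw (X ⊓ Y)) : Reg r tw (X ⊔ Y) := by
  let K : Submodule (MvPolynomial σ k) (ι ⊕ ι → MvPolynomial σ k) :=
    X.comap prL ⊓ Y.comap prR
  have hK : Reg r (Sum.elim tw tw) K := by
    refine Reg.ext ((hX.homSub.comap (grMap_prL tw tw)).inf (hY.homSub.comap (grMap_prR tw tw)))
      (grMap_prR tw tw) ?_ ?_
    · rw [inf_ker_prR K X]
      · exact hX.extInl tw
      · exact fun x => ⟨fun h => h.1, fun h => ⟨h, Y.zero_mem⟩⟩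
    · convert hY using 1
      ext y
      simp only [Submodule.mem_map]
      exact ⟨by rintro ⟨x, hx, rfl⟩; exact hx.2, fun h => ⟨Sum.elim 0 y, ⟨X.zero_mem, h⟩, rfl⟩⟩
  have hp := (grMap_prL (k := k) (σ := σ) tw tw).add (grMap_prR tw tw)
  convert Reg.image (K := K) hp ?_ hK using 1
  · ext z
    simp only [Submodule.mem_map, Submodule.mem_sup]
    constructor
    · rintro ⟨x, hx, y, hy, rfl⟩
      exact ⟨Sum.elim x y, ⟨hx, hy⟩, rfl⟩
    · rintro ⟨w, hw, rfl⟩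
      exact ⟨_, hw.1, _, hw.2, rfl⟩
  · have hid : GrMap tw tw (LinearMap.id : (ι → MvPolynomial σ k) →ₗ[MvPolynomial σ k] _) :=
      fun _ _ h => h
    convert hXY.map (hid.pairMap hid.neg) ?_ using 1
    · ext w
      simp only [Submodule.mem_inf, Submodule.mem_map, LinearMap.mem_ker]
      constructor
      · rintro ⟨h1, h2⟩
        have h3 : prR w = -prL w := eq_neg_of_add_eq_zero_right h2
        refine ⟨prL w, ⟨h1.1, ?_⟩, ?_⟩
        · have := Y.neg_mem h1.2
          rwa [h3, neg_neg] at this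
        · ext1 (l | l)
          · rfl
          · exact (congrFun h3 l).symm
      · rintro ⟨x, ⟨h1, h2⟩, rfl⟩
        exact ⟨⟨h1, Y.neg_mem h2⟩, add_neg_cancel x⟩
    · intro x _ hx
      ext1 l
      exact congrFun hx (Sum.inl l)

/-- Passing from a presentation of the cokernel of `Q` to `Q` itself. -/
lemma Reg.of_comap {κ : Type} [Fintype κ] [Fintype ι] {r : ℤ} {u : κ → ℤ} {tw : ι → ℤ}
    {Q : Submodule (MvPolynomial σ k) (ι → MvPolynomial σ k)} (hQ : HomSub tw Q)
    {ψ : (κ → MvPolynomial σ k) →ₗ[MvPolynomial σ k] (ι → MvPolynomial σ k)}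
    (hψ : GrMap u tw ψ) (hsurj : ∀ x, ∃ f, x - ψ f ∈ Q) (hu : ∀ l, u l ≤ r + 1)
    (htw : ∀ l, tw l ≤ r) (h : Reg r u (Q.comap ψ)) : Reg r tw Q := by
  let θ := prR + -(ψ ∘ₗ prL)
  have hθ : GrMap (Sum.elim u tw) tw θ := (grMap_prR u tw).add (hψ.comp (grMap_prL u tw)).neg
  have hθelim : ∀ f a, θ (Sum.elim f a) = a - ψ f := fun f a => (sub_eq_add_neg _ _).symm
  have hW : Reg r (Sum.elim u tw) (Q.comap θ) := by
    refine Reg.ext (hQ.comap hθ) (grMap_prR u tw) ?_ ?_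
    · rw [inf_ker_prR _ (Q.comap ψ)]
      · exact h.extInl tw
      · intro x
        rw [Submodule.mem_comap, hθelim, zero_sub, Submodule.mem_comap, neg_mem_iff]
    · convert reg_top (k := k) (σ := σ) htw using 1
      rw [eq_top_iff]
      intro a _
      obtain ⟨f, hf⟩ := hsurj a
      exact ⟨Sum.elim f a, by rwa [SetLike.mem_coe, Submodule.mem_comap, hθelim], rfl⟩
  convert Reg.image (K := Q.comap θ) hθ ?_ hW using 1
  · rw [Submodule.map_comap_eq_of_surjective]
    exact fun a => ⟨Sum.elim 0 a, by rw [hθelim, map_zero, sub_zero]⟩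
  · have hid : GrMap u u (LinearMap.id : (κ → MvPolynomial σ k) →ₗ[MvPolynomial σ k] _) :=
      fun _ _ h => h
    convert (reg_top (k := k) (σ := σ) hu).map (hid.pairMap hψ) ?_ using 1
    · ext w
      simp only [Submodule.mem_inf, Submodule.mem_map, LinearMap.mem_ker, Submodule.mem_comap]
      constructor
      · rintro ⟨-, h2⟩
        have h3 : prR w = ψ (prL w) := eq_of_sub_eq_zero ((sub_eq_add_neg _ _).trans h2)
        refine ⟨prL w, trivial, ?_⟩
        ext1 (l | l)
        · rfl
        · exact (congrFun h3 l).symm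
      · rintro ⟨x, -, rfl⟩
        have : θ (pairMap LinearMap.id ψ x) = 0 := (hθelim x (ψ x)).trans (sub_self _)
        rw [this]
        exact ⟨Q.zero_mem, rfl⟩
    · intro x _ hx
      ext1 l
      exact congrFun hx (Sum.inl l)

/-- An ideal viewed as a submodule of the free module of rank one. -/
noncomputable def idl (Q : Ideal (MvPolynomial σ k)) :
    Submodule (MvPolynomial σ k) (Unit → MvPolynomial σ k) :=
  Submodule.comap (LinearMap.proj ()) Q

lemma mem_idl {Q : Ideal (MvPolynomial σ k)} {f : Unit → MvPolynomial σ k} :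
    f ∈ idl Q ↔ f () ∈ Q := Iff.rfl

/-- Bounds on the graded free resolution of an ideal. -/
def IReg (r : ℤ) (Q : Ideal (MvPolynomial σ k)) : Prop :=
  Reg r (fun _ : Unit => 0) (idl Q)

lemma IReg.mono {r r' : ℤ} {Q : Ideal (MvPolynomial σ k)} (h : IReg r Q) (hr : r ≤ r') :
    IReg r' Q := Reg.mono h hr

lemma iReg_top : IReg 0 (⊤ : Ideal (MvPolynomial σ k)) := reg_top fun _ => le_rfl

lemma IReg.sup {r : ℤ} {X Y : Ideal (MvPolynomial σ k)} (hX : IReg r X) (hY : IReg r Y)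
    (hXY : IReg (r + 1) (X ⊓ Y)) : IReg r (X ⊔ Y) := by
  suffices key : idl (X ⊔ Y) = idl X ⊔ idl Y by
    rw [IReg, key]
    exact Reg.sup hX hY hXY
  ext f
  simp only [mem_idl, Submodule.mem_sup]
  constructor
  · rintro ⟨x, hx, y, hy, h⟩
    exact ⟨fun _ => x, hx, fun _ => y, hy, funext fun _ => h⟩
  · rintro ⟨x, hx, y, hy, h⟩
    exact ⟨x (), hx, y (), hy, congrFun h ()⟩

lemma homSub_pi {Q : Ideal (MvPolynomial σ k)}
    (hQ : HomSub (fun _ : Unit => 0) (idl Q)) (tw : ι → ℤ) (s : Set ι) :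
    HomSub tw (Submodule.pi s fun _ => Q) := fun f hf t l hl => by
  have := hQ (fun _ => f l) (hf l hl) (t - tw l)
  rw [mem_idl, compV_apply, sub_zero] at this
  exact this

/-- A direct sum of twisted copies of an ideal. -/
lemma IReg.pi [Fintype ι] {r c : ℤ} {Q : Ideal (MvPolynomial σ k)} (h : IReg r Q) {tw : ι → ℤ}
    (htw : ∀ l, tw l ≤ c) : Reg (c + r) tw (Submodule.pi Set.univ fun _ => Q) := by
  classical
  let E (s : Finset ι) : Submodule (MvPolynomial σ k) (ι → MvPolynomial σ k) :=
    (Submodule.pi Set.univ fun _ => Q) ⊓ (Submodule.pi (sᶜ : Finset ι) fun _ => ⊥)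
  have hbot : HomSub (fun _ : Unit => 0) (idl (⊥ : Ideal (MvPolynomial σ k))) := by
    intro f hf t
    have : f = 0 := funext fun _ => hf
    rw [this, map_zero]
    exact Submodule.zero_mem _
  have hE : ∀ s, HomSub tw (E s) := fun s =>
    (homSub_pi h.homSub tw _).inf (homSub_pi hbot tw _)
  have key : ∀ s, Reg (c + r) tw (E s) := by
    intro s
    induction s using Finset.induction_on with
    | empty =>
      convert reg_bot (c + r) tw using 1
      rw [eq_bot_iff]
      rintro f ⟨-, hf⟩
      ext1 l
      exact hf l (by simp)
    | insert a s ha ih =>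
      refine Reg.ext (hE _) (grMap_funLeft tw fun _ : Unit => a) ?_ ?_
      · convert ih using 1
        ext f
        simp only [Submodule.mem_inf, LinearMap.mem_ker, Submodule.mem_pi, E, Submodule.mem_bot]
        constructor
        · rintro ⟨⟨h1, h2⟩, h3⟩
          refine ⟨h1, fun l hl => ?_⟩
          by_cases hla : l = a
          · subst hla
            exact congrFun h3 ()
          · refine h2 l ?_
            simp only [Finset.coe_compl, Set.mem_compl_iff, Finset.mem_coe] at hl ⊢
            simp [hl, hla]
        · rintro ⟨h1, h2⟩
          refine ⟨⟨h1, fun l hl => h2 l ?_⟩, funext fun _ => h2 a (by simpa using ha)⟩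
          simp only [Finset.coe_compl, Set.mem_compl_iff, Finset.mem_coe] at hl ⊢
          exact fun h => hl (Finset.mem_insert_of_mem h)
      · have h' := (Reg.shift h (tw a)).mono (r' := c + r) (by linarith [htw a])
        have e : (tw ∘ fun _ : Unit => a) = fun l => (fun _ : Unit => (0 : ℤ)) l + tw a := by
          ext
          simp
        rw [e]
        convert h' using 1
        ext f
        simp only [Submodule.mem_map]
        constructor
        · rintro ⟨x, hx, rfl⟩
          exact hx.1 a trivial
        · intro hf
          refine ⟨Pi.single a (f ()), ⟨fun l _ => ?_, fun l hl => ?_⟩, ?_⟩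
          · by_cases hla : l = a
            · subst hla
              rw [Pi.single_eq_same]
              exact hf
            · rw [Pi.single_eq_of_ne hla]
              exact Q.zero_mem
          · have : l ≠ a := by
              rintro rfl
              simp at hl
            exact Pi.single_eq_of_ne this _
          · ext1 l
            change (Pi.single a (f ()) : ι → MvPolynomial σ k) a = f ()
            rw [Pi.single_eq_same]
  convert key Finset.univ using 1
  ext f
  simp [E, Submodule.mem_pi]

end Constructions

end PaperHTT

namespace PaperHTT

variable {k : Type} [Field k]

section Product

variable {α β τ κ : Type}

/-- The variables `τ` split as the disjoint union of the images of `g` and `h`. -/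
def IsSplit (k : Type) [Field k] (g : α → τ) (h : β → τ) : Prop :=
  (∃ v : τ → MvPolynomial β (MvPolynomial α k), (∀ a, v (g a) = C (X a)) ∧ ∀ b, v (h b) = X b) ∧
    ∀ t, (∃ a, g a = t) ∨ ∃ b, h b = t

lemma isSplit_inl_inr : IsSplit k (Sum.inl : α → α ⊕ β) Sum.inr :=
  ⟨⟨Sum.elim (fun a => C (X a)) X, fun _ => rfl, fun _ => rfl⟩,
    fun t => t.casesOn (fun a => Or.inl ⟨a, rfl⟩) fun b => Or.inr ⟨b, rfl⟩⟩

lemma isSplit_inr_inl : IsSplit k (Sum.inr : α → β ⊕ α) Sum.inl :=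
  ⟨⟨Sum.elim X (fun a => C (X a)), fun _ => rfl, fun _ => rfl⟩,
    fun t => t.casesOn (fun a => Or.inr ⟨a, rfl⟩) fun b => Or.inl ⟨b, rfl⟩⟩

variable {g : α → τ} {h : β → τ}

lemma IsSplit.mem_of_sum_mem (hs : IsSplit k g h) (I : Ideal (MvPolynomial α k)) {ι : Type*}
    {b : ι → MvPolynomial β k} (hb : LinearIndependent k b) (S : Finset ι)
    (c : ι → MvPolynomial α k)
    (hmem : ∑ i ∈ S, rename g (c i) * rename h (b i) ∈ I.map (rename g)) :
    ∀ i ∈ S, c i ∈ I := by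
  obtain ⟨⟨v, hv₁, hv₂⟩, -⟩ := hs
  let Φ : MvPolynomial τ k →ₐ[k] MvPolynomial β (MvPolynomial α k) := aeval v
  have hΦ₁ : ∀ p, Φ (rename g p) = C p := fun p => by
    induction p using MvPolynomial.induction_on with
    | C a => simp only [rename_C, Φ, aeval_C]; rfl
    | add p q hp hq => simp only [map_add, hp, hq]
    | mul_X p a hp => rw [map_mul, map_mul, hp, rename_X, map_mul]; simp [Φ, hv₁]
  have hΦ₂ : ∀ p, Φ (rename h p) = map C p := fun p => by
    induction p using MvPolynomial.induction_on with
    | C a => simp only [rename_C, Φ, aeval_C, map_C]; rfl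
    | add p q hp hq => simp only [map_add, hp, hq]
    | mul_X p a hp => rw [map_mul, map_mul, hp, rename_X, map_mul]; simp [Φ, hv₂]
  have hle : I.map (rename g) ≤ (I.map C).comap Φ := by
    rw [Ideal.map_le_iff_le_comap]
    intro p hp
    rw [Ideal.mem_comap, Ideal.mem_comap, hΦ₁]
    exact Ideal.mem_map_of_mem _ hp
  have h1 := hle hmem
  rw [Ideal.mem_comap, MvPolynomial.mem_map_C_iff] at h1
  intro i₀ hi₀
  by_contra hc
  obtain ⟨l, hl, hlI⟩ := Submodule.exists_le_ker_of_notMem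
    (p := I.restrictScalars k) (v := c i₀) hc
  refine hl (linearIndependent_iff'.1 hb S (fun i => l (c i)) ?_ i₀ hi₀)
  ext ν
  have h2 := hlI (h1 ν)
  rw [LinearMap.mem_ker] at h2
  rw [coeff_zero]
  refine Eq.trans ?_ h2
  simp only [map_sum, map_mul, hΦ₁, hΦ₂, coeff_sum, coeff_C_mul, coeff_map, coeff_smul]
  refine Finset.sum_congr rfl fun i _ => ?_
  rw [mul_comm (c i), ← smul_eq_C_mul, map_smul, smul_eq_mul, smul_eq_mul, mul_comm]

lemma IsSplit.exists_sum_eq (hs : IsSplit k g h) (J : Ideal (MvPolynomial β k)) {ι : Type*}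
    (b : Module.Basis ι k (J.restrictScalars k)) {f : MvPolynomial τ k}
    (hf : f ∈ J.map (rename h)) :
    ∃ c : ι →₀ MvPolynomial α k, f = c.sum fun i a => rename g a * rename h (b i) := by
  let Θ : (ι →₀ MvPolynomial α k) →+ MvPolynomial τ k := Finsupp.liftAddHom fun i =>
    (AddMonoidHom.mulRight (rename h (b i : MvPolynomial β k))).comp
      (rename g : MvPolynomial α k →ₐ[k] MvPolynomial τ k).toRingHom.toAddMonoidHom
  have h1 : ∀ a, ∀ y ∈ J, rename g a * rename h y ∈ AddMonoidHom.mrange Θ := by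
    intro a y hy
    have hy' : y = ∑ i ∈ (b.repr ⟨y, hy⟩).support, b.repr ⟨y, hy⟩ i • (b i : MvPolynomial β k) := by
      have := congrArg Subtype.val (b.linearCombination_repr ⟨y, hy⟩)
      rw [Finsupp.linearCombination_apply, Finsupp.sum] at this
      conv_lhs => rw [← Subtype.coe_mk y hy, ← this]
      simp
    have e := congrArg (rename h) hy'
    rw [map_sum] at e
    rw [e, Finset.mul_sum]
    refine sum_mem fun i _ => ⟨Finsupp.single i (C (b.repr ⟨y, hy⟩ i) * a), ?_⟩
    simp only [Θ, Finsupp.liftAddHom_apply_single]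
    change rename g (C _ * a) * rename h _ = _
    rw [map_mul, rename_C, smul_eq_C_mul, map_mul, rename_C]
    ring
  have h2 : ∀ p, ∀ a, ∀ y ∈ J, p * (rename g a * rename h y) ∈ AddMonoidHom.mrange Θ := by
    intro p
    induction p using MvPolynomial.induction_on with
    | C c =>
      intro a y hy
      have := h1 (C c * a) y hy
      rwa [map_mul, rename_C, mul_assoc] at this
    | add p q hp hq =>
      intro a y hy
      rw [add_mul]
      exact add_mem (hp a y hy) (hq a y hy)
    | mul_X p t hp =>
      intro a y hy
      rcases hs.2 t with ⟨x, rfl⟩ | ⟨x, rfl⟩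
      · have := hp (X x * a) y hy
        rwa [map_mul, rename_X, mul_assoc, ← mul_assoc p] at this
      · have := hp a (X x * y) (J.mul_mem_left _ hy)
        rwa [map_mul, rename_X, mul_left_comm (rename g a), ← mul_assoc p] at this
  have h3 : f ∈ AddMonoidHom.mrange Θ := by
    refine Submodule.span_induction (p := fun x _ => ∀ p, p * x ∈ AddMonoidHom.mrange Θ)
      ?_ ?_ ?_ ?_ hf 1 |> fun h => by rwa [one_mul] at h
    · rintro _ ⟨y, hy, rfl⟩ p
      have := h2 p 1 y hy
      rwa [map_one, one_mul] at this
    · intro p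
      rw [mul_zero]
      exact zero_mem _
    · intro x y _ _ hx hy p
      rw [mul_add]
      exact add_mem (hx p) (hy p)
    · intro a x _ hx p
      rw [smul_eq_mul, ← mul_assoc]
      exact hx _
  obtain ⟨c, rfl⟩ := h3
  exact ⟨c, rfl⟩

lemma IsSplit.inf_eq_mul (hs : IsSplit k g h) (I : Ideal (MvPolynomial α k))
    (J : Ideal (MvPolynomial β k)) :
    I.map (rename g) ⊓ J.map (rename h) = I.map (rename g) * J.map (rename h) := by
  refine le_antisymm ?_ Ideal.mul_le_inf
  rintro f ⟨hfI, hfJ⟩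
  let b := Module.Basis.ofVectorSpace k (J.restrictScalars k)
  obtain ⟨c, rfl⟩ := hs.exists_sum_eq J b hfJ
  have hb : LinearIndependent k fun i => (b i : MvPolynomial β k) :=
    b.linearIndependent.map' (Submodule.subtype _) (Submodule.ker_subtype _)
  exact sum_mem fun i hi => Ideal.mul_mem_mul
    (Ideal.mem_map_of_mem _ (hs.mem_of_sum_mem I hb c.support c hfI i hi))
    (Ideal.mem_map_of_mem _ (b i).2)

/-- Coordinatewise renaming of the variables. -/
noncomputable def renV (g : α → τ) (y : κ → MvPolynomial α k) : κ → MvPolynomial τ k :=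
  fun l => rename g (y l)

/-- The submodule generated by the products of elements of the ideal `E` with elements of `K`. -/
noncomputable def extSub (g : α → τ) (E : Ideal (MvPolynomial τ k))
    (K : Submodule (MvPolynomial α k) (κ → MvPolynomial α k)) :
    Submodule (MvPolynomial τ k) (κ → MvPolynomial τ k) :=
  Submodule.span _ {x | ∃ e ∈ E, ∃ y ∈ K, x = e • renV g y}

lemma homogZ.rename {p : MvPolynomial α k} {e : ℤ} (hp : homogZ k p e) (g : α → τ) :
    homogZ k (MvPolynomial.rename g p) e := by
  rcases hp with rfl | ⟨he, hp⟩
  · rw [map_zero]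
    exact homogZ_zero e
  · exact Or.inr ⟨he, hp.rename_isHomogeneous⟩

lemma linearCombination_renV {m : ℕ}
    (φ : (Fin m → MvPolynomial α k) →ₗ[MvPolynomial α k] (κ → MvPolynomial α k))
    (y : Fin m → MvPolynomial α k) :
    Fintype.linearCombination (MvPolynomial τ k) (fun l => renV g (φ (Pi.single l 1)))
      (renV g y) = renV g (φ y) := by
  rw [Fintype.linearCombination_apply]
  have : φ y = ∑ l, y l • φ (Pi.single l 1) := by
    conv_lhs => rw [pi_eq_sum_univ' y, map_sum]
    refine Finset.sum_congr rfl fun l _ => ?_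
    rw [map_smul]
  rw [this]
  ext1 j
  simp [renV, Finset.sum_apply]

lemma IsSplit.reg_extSub (hs : IsSplit k g h) {J : Ideal (MvPolynomial β k)} {s : ℤ}
    (hJ : IReg s (J.map (rename h))) {N : ℕ} {r : ℤ} {tw : κ → ℤ}
    {K : Submodule (MvPolynomial α k) (κ → MvPolynomial α k)} (hK : RegN N r tw K) :
    Reg (r + s) tw (extSub g (J.map (rename h)) K) := by
  induction N generalizing r κ with
  | zero =>
    have hK : K = ⊥ := hK
    convert reg_bot (r + s) tw
    rw [eq_bot_iff, extSub, Submodule.span_le]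
    rintro _ ⟨e, _, y, hy, rfl⟩
    rw [hK, Submodule.mem_bot] at hy
    rw [hy]
    ext1 l
    simp [renV]
  | succ N ih =>
    obtain ⟨m, u, φ, hu, hφ, rfl, hφk⟩ := hK
    let φ' := Fintype.linearCombination (MvPolynomial τ k) (fun l => renV g (φ (Pi.single l 1)))
    have hφ'g : GrMap u tw φ' := grMap_linearCombination fun l j =>
      (hφ _ _ (HomV_single u l) j).rename g
    have hφ' : ∀ y, φ' (renV g y) = renV g (φ y) := linearCombination_renV φ
    convert Reg.image hφ'g ?_ (hJ.pi hu) using 1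
    · apply le_antisymm
      · rw [extSub, Submodule.span_le]
        rintro _ ⟨e, he, _, ⟨z, rfl⟩, rfl⟩
        refine ⟨e • renV g z, fun l _ => Ideal.mul_mem_right _ _ he, ?_⟩
        rw [map_smul, hφ']
      · rintro _ ⟨f, hf, rfl⟩
        rw [Fintype.linearCombination_apply]
        exact sum_mem fun l _ => Submodule.subset_span ⟨f l, hf l trivial, _, ⟨_, rfl⟩, rfl⟩
    · convert ih hφk using 1
      · ring
      apply le_antisymm
      · rintro f ⟨hf, hf0⟩
        let b := Module.Basis.ofVectorSpace k (J.restrictScalars k)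
        have hb : LinearIndependent k fun i => (b i : MvPolynomial β k) :=
          b.linearIndependent.map' (Submodule.subtype _) (Submodule.ker_subtype _)
        choose c hc using fun l => hs.exists_sum_eq (g := g) J b (hf l trivial)
        classical
        let S := Finset.univ.biUnion fun l => (c l).support
        have hfS : f = ∑ i ∈ S, rename h (b i : MvPolynomial β k) • renV g (fun l => c l i) := by
          ext1 l
          rw [hc l, Finsupp.sum_of_support_subset (s := S)]
          · simp [renV, Finset.sum_apply, mul_comm]
          · exact Finset.subset_biUnion_of_mem (fun l => (c l).support) (Finset.mem_univ l)
          · simp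
        have hker : ∀ i ∈ S, φ (fun l => c l i) = 0 := by
          intro i hi
          ext1 j
          refine (Submodule.mem_bot (MvPolynomial α k)).1 (hs.mem_of_sum_mem ⊥ hb S
            (fun i => φ (fun l => c l i) j) ?_ i hi)
          have h0 : φ' f = 0 := hf0
          rw [hfS, map_sum] at h0
          simp only [map_smul, hφ'] at h0
          have := congrFun h0 j
          rw [Finset.sum_apply] at this
          convert Ideal.zero_mem _
          rw [← Pi.zero_apply (M := fun _ => MvPolynomial τ k) j, ← this]
          exact Finset.sum_congr rfl fun i _ => mul_comm _ _
        rw [hfS]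
        exact sum_mem fun i hi => Submodule.subset_span
          ⟨_, Ideal.mem_map_of_mem _ (b i).2, _, hker i hi, rfl⟩
      · rw [extSub, Submodule.span_le]
        rintro _ ⟨e, he, z, hz, rfl⟩
        refine ⟨fun l _ => Ideal.mul_mem_right _ _ he, ?_⟩
        change φ' _ = 0
        rw [LinearMap.mem_ker] at hz
        rw [map_smul, hφ', hz]
        ext1 j
        simp [renV]

lemma IsSplit.iReg_mul (hs : IsSplit k g h) {I : Ideal (MvPolynomial α k)}
    {J : Ideal (MvPolynomial β k)} {r s : ℤ} (hI : IReg r I) (hJ : IReg s (J.map (rename h))) :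
    IReg (r + s) (I.map (rename g) * J.map (rename h)) := by
  obtain ⟨N, hI⟩ := hI
  have key : idl (I.map (rename g) * J.map (rename h)) =
      extSub g (J.map (rename h)) (idl I) := by
    apply le_antisymm
    · have : I.map (rename g) * J.map (rename h) ≤
          (extSub g (J.map (rename h)) (idl I)).comap
            (LinearMap.pi fun _ : Unit => LinearMap.id) := by
        rw [Ideal.map, ← Ideal.span_eq (J.map (rename h)), Ideal.span_mul_span', Ideal.span_le]
        rintro _ ⟨_, ⟨y, hy, rfl⟩, e, he, rfl⟩
        exact Submodule.subset_span ⟨e, by rwa [Ideal.span_eq], fun _ => y, hy, funext fun _ => mul_comm _ _⟩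
      exact fun f hf => this hf
    · rw [extSub, Submodule.span_le]
      rintro _ ⟨e, he, y, hy, rfl⟩
      have h1 : rename g (y ()) * e ∈ I.map (rename g) * J.map (rename h) :=
        Ideal.mul_mem_mul (Ideal.mem_map_of_mem _ (mem_idl.1 hy)) he
      rw [mul_comm (rename g (y ()))] at h1
      exact mem_idl.2 h1
  rw [IReg, key]
  exact hs.reg_extSub hJ hI

lemma IsSplit.iReg_map (hs : IsSplit k g h) {I : Ideal (MvPolynomial α k)} {r : ℤ}
    (hI : IReg r I) : IReg r (I.map (rename g)) := by
  have := hs.iReg_mul (J := ⊤) (s := 0) hI (by rw [Ideal.map_top]; exact iReg_top)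
  rwa [Ideal.map_top, Ideal.mul_top, add_zero] at this

end Product

end PaperHTT

namespace PaperHTT

variable {k : Type} [Field k] {σ : Type}

section Syzygy

variable {ι ι' : Type}

lemma exists_graded_surjection [Finite σ] [Finite ι] {tw : ι → ℤ}
    {K : Submodule (MvPolynomial σ k) (ι → MvPolynomial σ k)} (hK : HomSub tw K) :
    ∃ (κ : Type) (_ : Fintype κ) (u : κ → ℤ)
      (φ : (κ → MvPolynomial σ k) →ₗ[MvPolynomial σ k] (ι → MvPolynomial σ k)),
      GrMap u tw φ ∧ LinearMap.range φ = K := by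
  obtain ⟨S, hS⟩ : K.FG := IsNoetherian.noetherian K
  choose T hT using exists_sum_compV (k := k) (σ := σ) tw
  refine ⟨Σ s : S, T s.1, inferInstance, fun x => x.2.1,
    Fintype.linearCombination _ fun x => compV tw x.2.1 x.1.1,
    grMap_linearCombination fun x => HomV_compV _ _ _, ?_⟩
  rw [Fintype.range_linearCombination]
  apply le_antisymm
  · rw [Submodule.span_le]
    rintro _ ⟨x, rfl⟩
    exact hK _ (hS ▸ Submodule.subset_span x.1.2) _
  · rw [← hS, Submodule.span_le]
    intro s hs
    rw [SetLike.mem_coe, ← hT s]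
    exact sum_mem fun t ht => Submodule.subset_span ⟨⟨⟨s, hs⟩, ⟨t, ht⟩⟩, rfl⟩

lemma exists_reg_of_isEmpty [IsEmpty σ] [Fintype ι] {tw : ι → ℤ} {r : ℤ} (hr : ∀ l, tw l ≤ r)
    {K : Submodule (MvPolynomial σ k) (ι → MvPolynomial σ k)} (hK : HomSub tw K) :
    Reg r tw K := by
  classical
  suffices key : ∀ (s : Finset ι) (K : Submodule (MvPolynomial σ k) (ι → MvPolynomial σ k)),
      HomSub tw K → (∀ f ∈ K, ∀ l ∉ s, f l = 0) → Reg r tw K from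
    key Finset.univ K hK fun f _ l hl => absurd (Finset.mem_univ l) hl
  clear hK K
  intro s
  induction s using Finset.induction_on with
  | empty =>
    intro K hK h
    convert reg_bot r tw
    rw [eq_bot_iff]
    exact fun f hf => funext fun l => h f hf l (by simp)
  | insert a s ha ih =>
    intro K hK h
    have hp := grMap_funLeft (k := k) (σ := σ) tw fun _ : Unit => a
    refine Reg.ext hK hp (ih _ (hK.inf (homSub_ker hp)) fun f hf l hl => ?_) ?_
    · by_cases hla : l = a
      · subst hla
        exact congrFun hf.2 ()
      · exact h f hf.1 l (by simp [hl, hla])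
    · by_cases hb : ∀ f ∈ K, f a = 0
      · convert reg_bot (k := k) (σ := σ) r (tw ∘ fun _ : Unit => a)
        rw [eq_bot_iff]
        rintro _ ⟨f, hf, rfl⟩
        exact funext fun _ => hb f hf
      · push Not at hb
        obtain ⟨f, hf, hfa⟩ := hb
        convert reg_top (k := k) (σ := σ) (tw := tw ∘ fun _ : Unit => a) fun _ => hr a
        rw [eq_top_iff]
        intro y _
        obtain ⟨c, hc⟩ := C_surjective σ (f a)
        have hc0 : c ≠ 0 := by
          rintro rfl
          exact hfa (by rw [← hc, C_0])
        refine ⟨(y () * C c⁻¹) • f, K.smul_mem _ hf, funext fun _ => ?_⟩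
        change y () * C c⁻¹ * f a = y ()
        rw [← hc, mul_assoc, ← C_mul, inv_mul_cancel₀ hc0, C_1, mul_one]

end Syzygy

section HyperplaneSection

variable {r : ℕ} {ι ι' : Type}

/-- Setting the first variable equal to zero. -/
noncomputable def cutX : MvPolynomial (Fin (r + 1)) k →ₐ[k] MvPolynomial (Fin r) k :=
  aeval (Fin.cases 0 X)

lemma cutX_X_zero : cutX (X 0 : MvPolynomial (Fin (r + 1)) k) = 0 := by simp [cutX]

lemma cutX_rename (p : MvPolynomial (Fin r) k) : cutX (rename Fin.succ p) = p := by
  rw [cutX, aeval_rename]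
  exact aeval_X_left_apply p

lemma homogZ.cutX {p : MvPolynomial (Fin (r + 1)) k} {e : ℤ} (hp : homogZ k p e) :
    homogZ k (cutX p) e := by
  rcases hp with rfl | ⟨he, hp⟩
  · rw [map_zero]
    exact homogZ_zero e
  · refine Or.inr ⟨he, ?_⟩
    have := hp.aeval (n := 1) (Fin.cases (0 : MvPolynomial (Fin r) k) X) fun i => by
      refine Fin.cases ?_ (fun j => ?_) i
      · exact isHomogeneous_zero _ _ _
      · exact isHomogeneous_X _ _
    rwa [one_mul] at this

lemma exists_sub_rename_cutX (f : MvPolynomial (Fin (r + 1)) k) :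
    ∃ q, f = rename Fin.succ (cutX f) + X 0 * q := by
  induction f using MvPolynomial.induction_on with
  | C a => exact ⟨0, by simp [cutX]⟩
  | add p q hp hq =>
    obtain ⟨a, ha⟩ := hp
    obtain ⟨b, hb⟩ := hq
    refine ⟨a + b, ?_⟩
    conv_lhs => rw [ha, hb]
    simp only [map_add]
    ring
  | mul_X p i hp =>
    obtain ⟨a, ha⟩ := hp
    refine Fin.cases ⟨p, ?_⟩ (fun j => ⟨a * X j.succ, ?_⟩) i
    · rw [map_mul, cutX_X_zero, mul_zero, map_zero, zero_add, mul_comm]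
    · conv_lhs => rw [ha]
      simp only [map_mul, cutX, aeval_X, Fin.cases_succ, rename_X]
      ring

/-- Setting the first variable equal to zero in a free module. -/
noncomputable def cutV : (ι → MvPolynomial (Fin (r + 1)) k) →+ (ι → MvPolynomial (Fin r) k) :=
  (cutX (k := k) (r := r) : _ →+* _).toAddMonoidHom.compLeft ι

lemma cutV_apply (f : ι → MvPolynomial (Fin (r + 1)) k) (l : ι) : cutV f l = cutX (f l) := rfl

lemma cutV_smul (p : MvPolynomial (Fin (r + 1)) k) (f : ι → MvPolynomial (Fin (r + 1)) k) :
    cutV (p • f) = cutX p • cutV f := by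
  ext1 l
  rw [cutV_apply, Pi.smul_apply, Pi.smul_apply, cutV_apply, smul_eq_mul, smul_eq_mul, map_mul]

lemma cutV_renV (f : ι → MvPolynomial (Fin r) k) : cutV (renV Fin.succ f) = f := by
  ext1 l
  rw [cutV_apply, renV, cutX_rename]

lemma exists_of_cutV_eq_zero {f : ι → MvPolynomial (Fin (r + 1)) k} (hf : cutV f = 0) :
    ∃ q, f = (X 0 : MvPolynomial (Fin (r + 1)) k) • q := by
  choose q hq using fun l => exists_sub_rename_cutX (f l)
  refine ⟨q, funext fun l => ?_⟩
  have : cutX (f l) = 0 := congrFun hf l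
  rw [hq l, this, map_zero, zero_add]
  rfl

lemma cutV_compV [Finite ι] (tw : ι → ℤ) (t : ℤ) (f : ι → MvPolynomial (Fin (r + 1)) k) :
    cutV (compV tw t f) = compV tw t (cutV f) := by
  obtain ⟨S, hS⟩ := exists_sum_compV tw f
  conv_lhs => rw [← hS]
  conv_rhs => rw [← hS]
  simp only [map_sum]
  refine Finset.sum_congr rfl fun s _ => ?_
  have : HomV tw s (cutV (compV tw s f)) := fun l => (HomV_compV tw s f l).cutX
  rw [(HomV_compV tw s f).compV_eq t, this.compV_eq t]
  split_ifs <;> simp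

lemma cutV_linearCombination [Fintype ι'] (v : ι' → ι → MvPolynomial (Fin (r + 1)) k)
    (f : ι' → MvPolynomial (Fin (r + 1)) k) :
    cutV (Fintype.linearCombination _ v f) =
      Fintype.linearCombination (MvPolynomial (Fin r) k) (fun l => cutV (v l)) (cutV f) := by
  simp only [Fintype.linearCombination_apply, map_sum, cutV_smul]
  rfl

/-- The image of a submodule after setting the first variable equal to zero. -/
noncomputable def cutSub (K : Submodule (MvPolynomial (Fin (r + 1)) k) (ι → MvPolynomial (Fin (r + 1)) k)) :
    Submodule (MvPolynomial (Fin r) k) (ι → MvPolynomial (Fin r) k) where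
  carrier := {y | ∃ x ∈ K, cutV x = y}
  zero_mem' := ⟨0, K.zero_mem, map_zero _⟩
  add_mem' := by
    rintro _ _ ⟨x, hx, rfl⟩ ⟨y, hy, rfl⟩
    exact ⟨x + y, K.add_mem hx hy, map_add _ _ _⟩
  smul_mem' := by
    rintro a _ ⟨x, hx, rfl⟩
    exact ⟨rename Fin.succ a • x, K.smul_mem _ hx, by rw [cutV_smul, cutX_rename]⟩

lemma HomSub.cutSub [Finite ι] {tw : ι → ℤ}
    {K : Submodule (MvPolynomial (Fin (r + 1)) k) (ι → MvPolynomial (Fin (r + 1)) k)}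
    (hK : HomSub tw K) : HomSub tw (cutSub K) := by
  rintro _ ⟨x, hx, rfl⟩ t
  exact ⟨_, hK x hx t, cutV_compV tw t x⟩

lemma compV_X_smul [Finite ι] {σ : Type} (i : σ) (tw : ι → ℤ) (t : ℤ)
    (f : ι → MvPolynomial σ k) :
    compV tw t ((X i : MvPolynomial σ k) • f) = (X i : MvPolynomial σ k) • compV tw (t - 1) f := by
  have hX : homogZ k (X i : MvPolynomial σ k) 1 := Or.inr ⟨zero_le_one, isHomogeneous_X k i⟩
  have hg : GrMap tw (fun l => tw l - 1)
      (LinearMap.lsmul (MvPolynomial σ k) (ι → MvPolynomial σ k) (X i)) := by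
    intro t f hf l
    have := hX.mul (hf l)
    rwa [show 1 + (t - tw l) = t - (tw l - 1) by ring] at this
  have := hg.map_compV (t - 1) f
  rw [LinearMap.lsmul_apply, LinearMap.lsmul_apply] at this
  rw [this]
  ext1 l
  rw [compV_apply, compV_apply]
  congr 2
  ring

/-- A graded Nakayama lemma. -/
lemma HomSub.le_of_forall_exists [Finite ι] {σ : Type} (i : σ) {tw : ι → ℤ}
    {K L : Submodule (MvPolynomial σ k) (ι → MvPolynomial σ k)} (hL : HomSub tw L)
    (h : ∀ x ∈ K, ∃ y ∈ L, ∃ z ∈ K, x = y + (X i : MvPolynomial σ k) • z) : K ≤ L := by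
  have := Fintype.ofFinite ι
  obtain ⟨b, hb⟩ : ∃ b : ℤ, ∀ l, b ≤ tw l := by
    obtain ⟨b, hb⟩ := (Set.finite_range tw).bddBelow
    exact ⟨b, fun l => hb ⟨l, rfl⟩⟩
  have key : ∀ n : ℕ, ∀ t < b + n, ∀ x ∈ K, compV tw t x ∈ L := by
    intro n
    induction n with
    | zero =>
      intro t ht x _
      convert L.zero_mem
      ext1 l
      rcases HomV_compV tw t x l with h | ⟨h, -⟩
      · exact h
      · have := hb l
        simp at ht
        lia
    | succ n ih =>
      intro t ht x hx
      obtain ⟨y, hy, z, hz, rfl⟩ := h x hx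
      rw [map_add, compV_X_smul]
      exact L.add_mem (hL y hy t) (L.smul_mem _ (ih _ (by push_cast at ht; lia) z hz))
  intro x hx
  obtain ⟨S, hS⟩ := exists_sum_compV tw x
  rw [← hS]
  exact sum_mem fun t _ => key (t - b + 1).toNat t (by lia) x hx

/-- A resolution modulo a variable lifts, provided that the variable is a nonzerodivisor on
the cokernel. -/
lemma RegN.of_cutSub [Finite ι] {N : ℕ} {ρ : ℤ} {tw : ι → ℤ}
    {K : Submodule (MvPolynomial (Fin (r + 1)) k) (ι → MvPolynomial (Fin (r + 1)) k)}
    (hK : HomSub tw K)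
    (hX : ∀ f, (X 0 : MvPolynomial (Fin (r + 1)) k) • f ∈ K → f ∈ K)
    (h : RegN N ρ tw (cutSub K)) : RegN N ρ tw K := by
  induction N generalizing ρ ι with
  | zero =>
    have h : cutSub K = ⊥ := h
    change K = ⊥
    rw [eq_bot_iff]
    refine (homSub_bot tw).le_of_forall_exists 0 fun x hx => ⟨0, Submodule.zero_mem _, ?_⟩
    have h0 : cutV x ∈ cutSub K := ⟨x, hx, rfl⟩
    rw [h, Submodule.mem_bot] at h0
    obtain ⟨q, rfl⟩ := exists_of_cutV_eq_zero h0
    exact ⟨q, hX _ hx, (zero_add _).symm⟩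
  | succ N ih =>
    obtain ⟨m, u, φ, hu, hφ, hφr, hφk⟩ := h
    have lift : ∀ l, ∃ x ∈ K, HomV tw (u l) x ∧ cutV x = φ (Pi.single l 1) := fun l => by
      have h1 := hφ _ _ (HomV_single u l)
      have : φ (Pi.single l 1) ∈ cutSub K := hφr ▸ ⟨_, rfl⟩
      obtain ⟨x, hx, hxe⟩ := this
      refine ⟨compV tw (u l) x, hK x hx _, HomV_compV _ _ _, ?_⟩
      rw [cutV_compV, hxe, h1.compV_eq, if_pos rfl]
    choose v hvK hvh hv using lift
    let ψ := Fintype.linearCombination (MvPolynomial (Fin (r + 1)) k) v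
    have hψ : GrMap u tw ψ := grMap_linearCombination hvh
    have hψK : ∀ x, ψ x ∈ K := fun x => by
      rw [Fintype.linearCombination_apply]
      exact K.sum_mem fun i _ => K.smul_mem _ (hvK i)
    have hcut : ∀ x, cutV (ψ x) = φ (cutV x) := fun x => by
      rw [cutV_linearCombination]
      simp only [hv]
      conv_rhs => rw [pi_eq_sum_univ' (cutV x), map_sum]
      rw [Fintype.linearCombination_apply]
      refine Finset.sum_congr rfl fun l _ => ?_
      rw [map_smul]
    have hrange : LinearMap.range ψ = K := by
      apply le_antisymm
      · rintro _ ⟨x, rfl⟩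
        exact hψK x
      · refine (homSub_range hψ).le_of_forall_exists 0 fun x hx => ?_
        have : cutV x ∈ LinearMap.range φ := hφr ▸ ⟨x, hx, rfl⟩
        obtain ⟨y, hy⟩ := this
        obtain ⟨q, hq⟩ := exists_of_cutV_eq_zero (f := x - ψ (renV Fin.succ y)) (by
          rw [map_sub, hcut, cutV_renV, hy, sub_self])
        refine ⟨_, ⟨renV Fin.succ y, rfl⟩, q, hX _ ?_, ?_⟩
        · rw [← hq]
          exact K.sub_mem hx (hψK _)
        · rw [← hq]
          abel
    rw [← hrange]
    refine RegN.intro hu hψ (ih (homSub_ker hψ) ?_ ?_)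
    · intro f hf
      rw [LinearMap.mem_ker, map_smul] at hf
      exact (smul_eq_zero.1 hf).resolve_left (X_ne_zero 0)
    · convert hφk using 1
      ext y
      constructor
      · rintro ⟨x, hx, rfl⟩
        rw [LinearMap.mem_ker] at hx ⊢
        rw [← hcut, hx, map_zero]
      · intro hy
        rw [LinearMap.mem_ker] at hy
        obtain ⟨q, hq⟩ := exists_of_cutV_eq_zero (f := ψ (renV Fin.succ y)) (by
          rw [hcut, cutV_renV, hy])
        have : q ∈ LinearMap.range ψ := by
          rw [hrange]
          refine hX _ ?_
          rw [← hq]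
          exact hψK _
        obtain ⟨w, rfl⟩ := this
        refine ⟨renV Fin.succ y - (X 0 : MvPolynomial (Fin (r + 1)) k) • w, ?_, ?_⟩
        · rw [LinearMap.mem_ker, map_sub, map_smul, hq, sub_self]
        · rw [map_sub, cutV_renV, cutV_smul, cutX_X_zero, zero_smul, sub_zero]

/-- Hilbert's syzygy theorem, graded version. -/
theorem exists_reg [Fintype ι] {tw : ι → ℤ}
    {K : Submodule (MvPolynomial (Fin r) k) (ι → MvPolynomial (Fin r) k)} (hK : HomSub tw K) :
    ∃ ρ, Reg ρ tw K := by
  induction r generalizing ι with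
  | zero =>
    obtain ⟨b, hb⟩ := (Set.finite_range tw).bddAbove
    exact ⟨b, exists_reg_of_isEmpty (fun l => hb ⟨l, rfl⟩) hK⟩
  | succ r ih =>
    obtain ⟨κ, _, u, φ, hφ, rfl⟩ := exists_graded_surjection hK
    obtain ⟨b, hb⟩ := (Set.finite_range u).bddAbove
    obtain ⟨ρ, N, hN⟩ := ih (homSub_ker hφ).cutSub
    have h1 : RegN N ρ u (LinearMap.ker φ) := RegN.of_cutSub (homSub_ker hφ) (fun f hf => by
      rw [LinearMap.mem_ker, map_smul] at hf
      exact (smul_eq_zero.1 hf).resolve_left (X_ne_zero 0)) hN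
    exact ⟨max b ρ, N + 1, RegN.intro (fun l => (hb ⟨l, rfl⟩).trans (le_max_left _ _)) hφ
      (h1.mono le_rfl ((le_max_right b ρ).trans (by lia)))⟩

end HyperplaneSection

end PaperHTT

namespace PaperHTT

variable {k : Type} [Field k] {σ : Type}

section Resolutions

lemma mem_quotGr {Q : Ideal (MvPolynomial σ k)} {t : ℤ} {x : MvPolynomial σ k ⧸ Q} :
    x ∈ quotGr k Q t ↔ ∃ f, homogZ k f t ∧ x = Ideal.Quotient.mk Q f := by
  refine ⟨fun hx => ?_, fun hx => AddSubgroup.subset_closure hx⟩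
  induction hx using AddSubgroup.closure_induction with
  | mem x hx => exact hx
  | zero => exact ⟨0, homogZ_zero t, (map_zero _).symm⟩
  | add x y _ _ hx hy =>
    obtain ⟨f, hf, rfl⟩ := hx
    obtain ⟨g, hg, rfl⟩ := hy
    exact ⟨f + g, hf.add hg, (map_add _ _ _).symm⟩
  | neg x _ hx =>
    obtain ⟨f, hf, rfl⟩ := hx
    exact ⟨-f, hf.neg, (map_neg _ _).symm⟩

lemma GradedFreeRes.grMap_d {M : Type} [AddCommGroup M] [Module (MvPolynomial σ k) M]
    {gr : ℤ → AddSubgroup M} (F : GradedFreeRes k σ M gr) (i : ℕ) :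
    GrMap (F.tw (i + 1)) (F.tw i) (F.d i) :=
  grMap_of_single fun l l' => F.d_homog i l l'

lemma GradedFreeRes.regN_range_d {M : Type} [AddCommGroup M] [Module (MvPolynomial σ k) M]
    {gr : ℤ → AddSubgroup M} (F : GradedFreeRes k σ M gr) {ρ : ℤ}
    (hρ : ∀ i l, F.tw i l - (i : ℤ) ≤ ρ) {N : ℕ} (hN : ∀ i, N ≤ i → F.rk i = 0) (n i : ℕ)
    (hni : N ≤ i + n) : RegN n (ρ + i + 1) (F.tw i) (LinearMap.range (F.d i)) := by
  induction n generalizing i with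
  | zero =>
    have h0 := hN i (by simpa using hni)
    have : IsEmpty (Fin (F.rk i)) := by
      rw [h0]
      infer_instance
    exact Subsingleton.elim _ _
  | succ n ih =>
    refine RegN.intro (fun l => ?_) (F.grMap_d i) ?_
    · have := hρ (i + 1) l
      push_cast at this
      lia
    · rw [← F.exact_succ]
      convert ih (i + 1) (by lia) using 1
      push_cast
      ring

/-- A graded free resolution of `P/Q` gives bounds on the resolution of `Q`. -/
lemma GradedFreeRes.iReg {Q : Ideal (MvPolynomial σ k)}
    (hQ : HomSub (fun _ : Unit => 0) (idl Q))
    (F : GradedFreeRes k σ (MvPolynomial σ k ⧸ Q) (quotGr k Q)) {ρ : ℤ} (h0 : 0 ≤ ρ + 1)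
    (hρ : ∀ i l, F.tw i l - (i : ℤ) ≤ ρ) : IReg (ρ + 1) Q := by
  choose h hh he using fun l => mem_quotGr.1 (F.aug_homog l)
  let ψ : (Fin (F.rk 0) → MvPolynomial σ k) →ₗ[MvPolynomial σ k] (Unit → MvPolynomial σ k) :=
    Fintype.linearCombination _ fun l _ => h l
  have hψ : GrMap (F.tw 0) (fun _ => 0) ψ := grMap_linearCombination fun l _ => by
    rw [sub_zero]
    exact hh l
  have haug : ∀ f, Ideal.Quotient.mk Q (ψ f ()) = F.aug f := fun f => by
    conv_rhs => rw [pi_eq_sum_univ' f, map_sum]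
    rw [Fintype.linearCombination_apply, Finset.sum_apply, map_sum]
    refine Finset.sum_congr rfl fun l _ => ?_
    rw [map_smul]
    have := he l
    refine Eq.trans ?_ (congrArg (f l • ·) this).symm
    rfl
  have hker : (idl Q).comap ψ = LinearMap.ker F.aug := by
    ext f
    rw [Submodule.mem_comap, mem_idl, LinearMap.mem_ker, ← haug, Ideal.Quotient.eq_zero_iff_mem]
  obtain ⟨N, hN⟩ := F.bdd
  refine Reg.of_comap hQ hψ (fun x => ?_) (fun l => ?_) (fun _ => h0) ⟨N, ?_⟩
  · obtain ⟨f, hf⟩ := F.aug_surj (Ideal.Quotient.mk Q (x ()))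
    refine ⟨f, ?_⟩
    rw [mem_idl, ← Ideal.Quotient.eq_zero_iff_mem, Pi.sub_apply, map_sub, haug, hf, sub_self]
  · have := hρ 0 l
    push_cast at this
    lia
  · rw [hker, ← F.exact_zero]
    have := F.regN_range_d hρ hN N 0 (by lia)
    rwa [Nat.cast_zero, add_zero] at this

/-- The grading induced on a submodule of a twisted free module. -/
def subGr {ι : Type} (tw : ι → ℤ) (K : Submodule (MvPolynomial σ k) (ι → MvPolynomial σ k))
    (t : ℤ) : AddSubgroup K where
  carrier := {x | HomV tw t x.1}
  add_mem' := HomV.add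
  zero_mem' := HomV_zero tw t
  neg_mem' := HomV.neg

/-- The resolution by zero modules. -/
noncomputable def GradedFreeRes.trivial {M : Type} [AddCommGroup M] [Module (MvPolynomial σ k) M]
    [Subsingleton M] (gr : ℤ → AddSubgroup M) : GradedFreeRes k σ M gr where
  rk _ := 0
  tw _ l := l.elim0
  bdd := ⟨0, fun _ _ => rfl⟩
  aug := 0
  d _ := 0
  aug_surj _ := ⟨0, Subsingleton.elim _ _⟩
  exact_zero := Subsingleton.elim _ _
  exact_succ _ := Subsingleton.elim _ _
  aug_homog l := l.elim0
  d_homog _ l := l.elim0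

/-- Splicing a resolution of the kernel of a free cover. -/
noncomputable def GradedFreeRes.cons {M : Type} [AddCommGroup M] [Module (MvPolynomial σ k) M]
    {gr : ℤ → AddSubgroup M} {q : ℕ} (tw : Fin q → ℤ)
    (aug : (Fin q → MvPolynomial σ k) →ₗ[MvPolynomial σ k] M)
    (hs : Function.Surjective aug) (hh : ∀ l, aug (Pi.single l 1) ∈ gr (tw l))
    (F : GradedFreeRes k σ (LinearMap.ker aug) (subGr tw (LinearMap.ker aug))) :
    GradedFreeRes k σ M gr where
  rk i := match i with
    | 0 => q
    | i + 1 => F.rk i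
  tw i := match i with
    | 0 => tw
    | i + 1 => F.tw i
  bdd := by
    obtain ⟨N, hN⟩ := F.bdd
    refine ⟨N + 1, fun i hi => ?_⟩
    cases i with
    | zero => lia
    | succ i => exact hN i (by lia)
  aug := aug
  d i := match i with
    | 0 => (LinearMap.ker aug).subtype ∘ₗ F.aug
    | i + 1 => F.d i
  aug_surj := hs
  exact_zero := by
    change LinearMap.range ((LinearMap.ker aug).subtype ∘ₗ F.aug) = _
    rw [LinearMap.range_comp_of_range_eq_top _ (LinearMap.range_eq_top.2 F.aug_surj),
      Submodule.range_subtype]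
  exact_succ i := by
    cases i with
    | zero =>
      refine F.exact_zero.trans ?_
      exact (LinearMap.ker_comp_of_ker_eq_bot _ (Submodule.ker_subtype _)).symm
    | succ i => exact F.exact_succ i
  aug_homog := hh
  d_homog i := by
    cases i with
    | zero => exact fun l => F.aug_homog l
    | succ i => exact F.d_homog i

lemma GradedFreeRes.cons_bound {M : Type} [AddCommGroup M] [Module (MvPolynomial σ k) M]
    {gr : ℤ → AddSubgroup M} {q : ℕ} {tw : Fin q → ℤ}
    {aug : (Fin q → MvPolynomial σ k) →ₗ[MvPolynomial σ k] M}
    {hs : Function.Surjective aug} {hh : ∀ l, aug (Pi.single l 1) ∈ gr (tw l)}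
    {F : GradedFreeRes k σ (LinearMap.ker aug) (subGr tw (LinearMap.ker aug))} {r : ℤ}
    (htw : ∀ l, tw l ≤ r) (hF : ∀ i l, F.tw i l - (i : ℤ) ≤ r + 1) (i : ℕ)
    (l : Fin ((GradedFreeRes.cons tw aug hs hh F).rk i)) :
    (GradedFreeRes.cons tw aug hs hh F).tw i l - (i : ℤ) ≤ r := by
  cases i with
  | zero =>
    rw [Nat.cast_zero, sub_zero]
    exact htw l
  | succ i =>
    have := hF i l
    change F.tw i l - _ ≤ r
    push_cast
    lia

lemma RegN.exists_gradedFreeRes {N : ℕ} {M : Type} [AddCommGroup M]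
    [Module (MvPolynomial σ k) M] {gr : ℤ → AddSubgroup M} {q : ℕ} {tw : Fin q → ℤ} {r : ℤ}
    {aug : (Fin q → MvPolynomial σ k) →ₗ[MvPolynomial σ k] M}
    (h : RegN N (r + 1) tw (LinearMap.ker aug))
    (hs : Function.Surjective aug) (hh : ∀ l, aug (Pi.single l 1) ∈ gr (tw l))
    (htw : ∀ l, tw l ≤ r) :
    ∃ F : GradedFreeRes k σ M gr, ∀ i (l : Fin (F.rk i)), F.tw i l - (i : ℤ) ≤ r := by
  induction N generalizing M q r with
  | zero =>
    have h : LinearMap.ker aug = ⊥ := h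
    have : Subsingleton (LinearMap.ker aug) := by
      rw [h]
      infer_instance
    exact ⟨.cons tw aug hs hh (.trivial _), GradedFreeRes.cons_bound htw fun i l => l.elim0⟩
  | succ N ih =>
    obtain ⟨m, u, φ, hu, hφ, hφr, hφk⟩ := h
    have hmem : ∀ x, φ x ∈ LinearMap.ker aug := fun x => hφr ▸ ⟨x, rfl⟩
    obtain ⟨F, hF⟩ := ih (aug := φ.codRestrict (LinearMap.ker aug) hmem)
      (gr := subGr tw (LinearMap.ker aug)) (tw := u) (r := r + 1)
      (by rwa [LinearMap.ker_codRestrict])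
      (by
        rintro ⟨y, hy⟩
        obtain ⟨x, hx⟩ : y ∈ LinearMap.range φ := hφr ▸ hy
        exact ⟨x, Subtype.ext hx⟩)
      (fun l => hφ _ _ (HomV_single u l)) hu
    exact ⟨.cons tw aug hs hh F, GradedFreeRes.cons_bound htw hF⟩

/-- Bounds on the resolution of `Q` give a graded free resolution of `P/Q`. -/
lemma IReg.exists_gradedFreeRes {Q : Ideal (MvPolynomial σ k)} {ρ : ℤ} (h0 : 0 ≤ ρ)
    (h : IReg (ρ + 1) Q) : ∃ F : GradedFreeRes k σ (MvPolynomial σ k ⧸ Q) (quotGr k Q),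
      ∀ i (l : Fin (F.rk i)), F.tw i l - (i : ℤ) ≤ ρ := by
  obtain ⟨N, h⟩ := h
  let aug : (Fin 1 → MvPolynomial σ k) →ₗ[MvPolynomial σ k] (MvPolynomial σ k ⧸ Q) :=
    Submodule.mkQ Q ∘ₗ LinearMap.proj 0
  have key : RegN N (ρ + 1) (fun _ : Fin 1 => 0) (LinearMap.ker aug) := by
    have h2 := h.map (grMap_funLeft (k := k) (σ := σ) (fun _ : Unit => 0) fun _ : Fin 1 => ())
      fun x _ hx => funext fun _ => congrFun hx 0
    refine (congrArg (RegN N (ρ + 1) fun _ : Fin 1 => (0 : ℤ)) ?_).mpr h2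
    ext f
    simp only [LinearMap.mem_ker, Submodule.mem_map]
    have h1 : aug f = 0 ↔ f 0 ∈ Q := Submodule.Quotient.mk_eq_zero Q
    rw [h1]
    constructor
    · intro hf
      refine ⟨fun _ => f 0, hf, funext fun l => ?_⟩
      rw [Subsingleton.elim l 0]
      rfl
    · rintro ⟨y, hy, rfl⟩
      exact hy
  refine key.exists_gradedFreeRes (fun x => ?_) (fun l => ?_) fun _ => h0
  · obtain ⟨f, rfl⟩ := Submodule.mkQ_surjective Q x
    exact ⟨fun _ => f, rfl⟩
  · refine mem_quotGr.2 ⟨1, homogZ_one, ?_⟩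
    rw [Subsingleton.elim l 0]
    change Submodule.mkQ Q ((Pi.single 0 1 : Fin 1 → MvPolynomial σ k) 0) = _
    rw [Pi.single_eq_same]
    rfl

lemma GradedFreeRes.nonneg_of_bound {Q : Ideal (MvPolynomial σ k)} (hQ : Q ≠ ⊤)
    (F : GradedFreeRes k σ (MvPolynomial σ k ⧸ Q) (quotGr k Q)) {ρ : ℤ}
    (hρ : ∀ i l, F.tw i l - (i : ℤ) ≤ ρ) : 0 ≤ ρ := by
  by_contra! h
  have h0 : F.aug = 0 := by
    refine LinearMap.pi_ext' fun l => LinearMap.ext_ring ?_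
    obtain ⟨f, hf, he⟩ := mem_quotGr.1 (F.aug_homog l)
    have := hρ 0 l
    push_cast at this
    rcases hf with rfl | ⟨hf, -⟩
    · rw [map_zero] at he
      exact he
    · lia
  refine hQ ((Ideal.eq_top_iff_one Q).2 ?_)
  obtain ⟨f, hf⟩ := F.aug_surj (Ideal.Quotient.mk Q 1)
  rw [h0, LinearMap.zero_apply] at hf
  exact Ideal.Quotient.eq_zero_iff_mem.1 hf.symm

lemma bddBelow_regQuot {Q : Ideal (MvPolynomial σ k)} (hQ : Q ≠ ⊤) :
    BddBelow {r : ℤ | ∃ F : GradedFreeRes k σ (MvPolynomial σ k ⧸ Q) (quotGr k Q),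
      ∀ i (l : Fin (F.rk i)), F.tw i l - (i : ℤ) ≤ r} :=
  ⟨0, fun _ ⟨F, hF⟩ => F.nonneg_of_bound hQ hF⟩

lemma IReg.regQuot_le {Q : Ideal (MvPolynomial σ k)} (hQ : Q ≠ ⊤) {ρ : ℤ} (h0 : 0 ≤ ρ)
    (h : IReg (ρ + 1) Q) : regQuot k Q ≤ ρ :=
  csInf_le (bddBelow_regQuot hQ) (h.exists_gradedFreeRes h0)

lemma IsHomogeneousIdeal.homSub {Q : Ideal (MvPolynomial σ k)} (hQ : IsHomogeneousIdeal k Q) :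
    HomSub (fun _ : Unit => 0) (idl Q) := by
  intro f hf t
  rw [mem_idl, compV_apply, compZ]
  split_ifs
  · exact hQ _ hf _
  · exact Q.zero_mem

lemma regQuot_spec {r : ℕ} {Q : Ideal (MvPolynomial (Fin r) k)} (hQ : Q ≠ ⊤)
    (hQh : IsHomogeneousIdeal k Q) : 0 ≤ regQuot k Q ∧ IReg (regQuot k Q + 1) Q := by
  have hmem : regQuot k Q ∈ {r' : ℤ | ∃ F : GradedFreeRes k (Fin r)
      (MvPolynomial (Fin r) k ⧸ Q) (quotGr k Q),
      ∀ i (l : Fin (F.rk i)), F.tw i l - (i : ℤ) ≤ r'} := by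
    refine Int.csInf_mem ?_ (bddBelow_regQuot hQ)
    obtain ⟨ρ, hρ⟩ := exists_reg hQh.homSub
    have hρ : IReg ρ Q := hρ
    exact ⟨max ρ 0, IReg.exists_gradedFreeRes (le_max_right _ _)
      (hρ.mono ((le_max_left ρ 0).trans (by lia)))⟩
  obtain ⟨F, hF⟩ := hmem
  have h0 := F.nonneg_of_bound hQ hF
  exact ⟨h0, F.iReg hQh.homSub (by lia) hF⟩

end Resolutions

end PaperHTT

namespace PaperHTT

variable {k : Type} [Field k]

section Powers

/-- A sum of two ideals, raised to a power, with the powers of one summand split off. -/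
lemma add_pow_succ_eq {R : Type} [CommRing R] (E F : Ideal R) (t : ℕ) :
    (E + F) ^ (t + 1) = E * (E + F) ^ t + F ^ (t + 1) := by
  induction t with
  | zero => simp
  | succ t ih =>
    have hle : E * F ^ (t + 1) ≤ E * (E + F) ^ (t + 1) :=
      Ideal.mul_mono_right (Ideal.pow_right_mono le_sup_right _)
    calc (E + F) ^ (t + 1 + 1)
        = E * (E + F) ^ (t + 1) + F * (E + F) ^ (t + 1) := by ring
      _ = E * (E + F) ^ (t + 1) + (E * (F * (E + F) ^ t) + F ^ (t + 1 + 1)) := by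
          nth_rewrite 2 [ih]
          ring
      _ = E * (E + F) ^ (t + 1) + F ^ (t + 1 + 1) := by
          rw [← add_assoc]
          congr 1
          refine sup_eq_left.2 (Ideal.mul_mono_right ?_)
          rw [pow_succ', add_mul]
          exact le_sup_right

variable {α β τ : Type} {g : α → τ} {h : β → τ}

/-- Regularity bound for `E ^ m * (E + F) ^ t`, built up one product `E ^ m * F ^ t` at a time. -/
lemma IsSplit.iReg_pow_mul_add_pow (hs : IsSplit k g h) (hs' : IsSplit k h g)
    (I : Ideal (MvPolynomial α k)) (J : Ideal (MvPolynomial β k)) {a b : ℕ → ℤ}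
    (ha : ∀ i, IReg (a i) (I ^ i)) (hb : ∀ j, IReg (b j) (J ^ j)) {n : ℕ} {w : ℤ}
    (h1 : ∀ m t, m + t = n → a m + b t ≤ w)
    (h2 : ∀ m t, m + t = n → 1 ≤ t → a (m + 1) + b t ≤ w + 1) (t : ℕ) :
    ∀ m, m + t = n →
      IReg w (I.map (rename g) ^ m * (I.map (rename g) + J.map (rename h)) ^ t) := by
  have hprod : ∀ i j, IReg (a i + b j) (I.map (rename g) ^ i * J.map (rename h) ^ j) := by
    intro i j
    rw [← Ideal.map_pow, ← Ideal.map_pow]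
    exact hs.iReg_mul (ha i) (hs'.iReg_map (hb j))
  induction t with
  | zero =>
    intro m hm
    simpa using (hprod m 0).mono (h1 m 0 hm)
  | succ t ih =>
    intro m hm
    set E := I.map (rename g) with hE
    set F := J.map (rename h) with hF
    have hsum : E ^ m * (E + F) ^ (t + 1) =
        (E ^ (m + 1) * (E + F) ^ t) ⊔ (E ^ m * F ^ (t + 1)) := by
      rw [add_pow_succ_eq, mul_add, ← mul_assoc, ← pow_succ]
      rfl
    have hinf : (E ^ (m + 1) * (E + F) ^ t) ⊓ (E ^ m * F ^ (t + 1)) =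
        E ^ (m + 1) * F ^ (t + 1) := by
      apply le_antisymm
      · refine (inf_le_inf Ideal.mul_le_left Ideal.mul_le_right).trans (le_of_eq ?_)
        rw [hE, hF, ← Ideal.map_pow _ I, ← Ideal.map_pow _ J]
        exact hs.inf_eq_mul (I ^ (m + 1)) (J ^ (t + 1))
      · refine le_inf (Ideal.mul_mono_right ?_)
          (Ideal.mul_mono_left (Ideal.pow_le_pow_right m.le_succ))
        exact (Ideal.pow_le_pow_right t.le_succ).trans (Ideal.pow_right_mono le_sup_right _)
    rw [hsum]
    refine IReg.sup (ih (m + 1) (by lia)) ((hprod m (t + 1)).mono (h1 _ _ hm)) ?_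
    rw [hinf]
    exact (hprod _ _).mono (h2 _ _ hm (by lia))

end Powers

section Homogeneous

variable {σ : Type}

attribute [local instance] MvPolynomial.gradedAlgebra in
lemma isHomogeneousIdeal_iff {Q : Ideal (MvPolynomial σ k)} :
    IsHomogeneousIdeal k Q ↔ Q.IsHomogeneous (homogeneousSubmodule σ k) :=
  ⟨fun h i f hf => (decomposition.decompose'_apply f i).symm ▸ h f hf i, fun h _ hf i => homogeneousComponent_mem_of_mem h hf i⟩

attribute [local instance] MvPolynomial.gradedAlgebra in
lemma IsHomogeneousIdeal.pow {Q : Ideal (MvPolynomial σ k)} (hQ : IsHomogeneousIdeal k Q)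
    (n : ℕ) : IsHomogeneousIdeal k (Q ^ n) := by
  induction n with
  | zero => intro f _ m; simp
  | succ n ih =>
    rw [isHomogeneousIdeal_iff] at hQ ih ⊢
    rw [pow_succ]
    exact ih.mul hQ

lemma IsHomogeneousIdeal.le_ker_constantCoeff {Q : Ideal (MvPolynomial σ k)}
    (hQ : IsHomogeneousIdeal k Q) (hQ1 : Q ≠ ⊤) : Q ≤ RingHom.ker (constantCoeff (R := k)) := by
  intro f hf
  rw [RingHom.mem_ker]
  by_contra hc
  have := hQ f hf 0
  rw [homogeneousComponent_zero] at this
  exact hQ1 (Q.eq_top_of_isUnit_mem this ((isUnit_iff_ne_zero.2 hc).map C))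

lemma pow_ne_top_of_ne_top {R : Type} [CommRing R] {Q : Ideal R} (hQ : Q ≠ ⊤) {n : ℕ}
    (hn : n ≠ 0) : Q ^ n ≠ ⊤ :=
  fun h => hQ (top_le_iff.1 (h ▸ Ideal.pow_le_self hn))

lemma sumIJ_ne_top {r s : ℕ} {I : Ideal (PA k r)} {J : Ideal (PB k s)} (hI1 : I ≠ ⊤)
    (hIh : IsHomogeneousIdeal k I) (hJ1 : J ≠ ⊤) (hJh : IsHomogeneousIdeal k J) :
    sumIJ k I J ≠ ⊤ := by
  have hle : sumIJ k I J ≤ RingHom.ker (constantCoeff (R := k)) := by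
    refine sup_le (Ideal.map_le_iff_le_comap.2 fun f hf => ?_)
      (Ideal.map_le_iff_le_comap.2 fun f hf => ?_)
    · rw [Ideal.mem_comap, RingHom.mem_ker, constantCoeff_rename]
      exact hIh.le_ker_constantCoeff hI1 hf
    · rw [Ideal.mem_comap, RingHom.mem_ker, constantCoeff_rename]
      exact hJh.le_ker_constantCoeff hJ1 hf
  exact fun h => RingHom.ker_ne_top (constantCoeff (R := k)) (top_le_iff.1 (h ▸ hle))

lemma regQuot_pow_spec {r : ℕ} {Q : Ideal (MvPolynomial (Fin r) k)} (hQ : Q ≠ ⊤)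
    (hQh : IsHomogeneousIdeal k Q) {n : ℕ} (hn : n ≠ 0) :
    0 ≤ regQuot k (Q ^ n) ∧ IReg (regQuot k (Q ^ n) + 1) (Q ^ n) :=
  regQuot_spec (pow_ne_top_of_ne_top hQ hn) (hQh.pow n)

lemma iReg_pow {r : ℕ} {Q : Ideal (MvPolynomial (Fin r) k)} (hQ : Q ≠ ⊤)
    (hQh : IsHomogeneousIdeal k Q) (n : ℕ) :
    IReg (if n = 0 then 0 else regQuot k (Q ^ n) + 1) (Q ^ n) := by
  split_ifs with hn
  · rw [hn, pow_zero, Ideal.one_eq_top]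
    exact iReg_top
  · exact (regQuot_pow_spec hQ hQh hn).2

end Homogeneous

end PaperHTT

open PaperHTT in
/-- Theorem 2.4(ii): for `n ≥ 1`,
`reg R/(I+J)^n ≤ max {reg A/I^(n-i) + reg B/J^i + 1, reg A/I^(n-j+1) + reg B/J^j}`,
the maximum taken over `1 ≤ i ≤ n-1` and `1 ≤ j ≤ n`. -/
theorem reg_quot_power_sum_le
    (k : Type) [Field k] (r s : ℕ)
    (I : Ideal (PA k r)) (J : Ideal (PB k s))
    (hI0 : I ≠ ⊥) (hI1 : I ≠ ⊤) (hIh : IsHomogeneousIdeal k I)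
    (hJ0 : J ≠ ⊥) (hJ1 : J ≠ ⊤) (hJh : IsHomogeneousIdeal k J)
    (n : ℕ) (hn : 1 ≤ n) :
    regQuot k ((sumIJ k I J) ^ n) ≤
      sSup {v : ℤ |
        (∃ i, 1 ≤ i ∧ i ≤ n - 1 ∧
          v = regQuot k (I ^ (n - i)) + regQuot k (J ^ i) + 1) ∨
        (∃ j, 1 ≤ j ∧ j ≤ n ∧
          v = regQuot k (I ^ (n - j + 1)) + regQuot k (J ^ j))} := by
  set V := {v : ℤ | _} with hV
  have hfin : V.Finite := by
    refine Set.Finite.union (Set.Finite.subset ((Finset.Icc 1 (n - 1)).finite_toSet.image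
      fun i => regQuot k (I ^ (n - i)) + regQuot k (J ^ i) + 1) ?_)
      (Set.Finite.subset ((Finset.Icc 1 n).finite_toSet.image
      fun j => regQuot k (I ^ (n - j + 1)) + regQuot k (J ^ j)) ?_)
    · rintro v ⟨i, hi, hi', rfl⟩
      exact ⟨i, by simp [hi, hi'], rfl⟩
    · rintro v ⟨j, hj, hj', rfl⟩
      exact ⟨j, by simp [hj, hj'], rfl⟩
  have hI : ∀ i, i ≠ 0 → 0 ≤ regQuot k (I ^ i) := fun i hi => (regQuot_pow_spec hI1 hIh hi).1
  have hJ : ∀ j, j ≠ 0 → 0 ≤ regQuot k (J ^ j) := fun j hj => (regQuot_pow_spec hJ1 hJh hj).1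
  have hv1 : ∀ m t, m + t = n → m ≠ 0 → t ≠ 0 →
      regQuot k (I ^ m) + regQuot k (J ^ t) + 1 ≤ sSup V := fun m t hmt hm ht =>
    le_csSup hfin.bddAbove (Or.inl ⟨t, by lia, by lia, by rw [show n - t = m by lia]⟩)
  have hv2 : ∀ m t, m + t = n → t ≠ 0 →
      regQuot k (I ^ (m + 1)) + regQuot k (J ^ t) ≤ sSup V := fun m t hmt ht =>
    le_csSup hfin.bddAbove (Or.inr ⟨t, by lia, by lia, by rw [show n - t = m by lia]⟩)
  have h0 : 0 ≤ sSup V :=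
    (add_nonneg (hI 1 one_ne_zero) (hJ n (by lia))).trans (hv2 0 n (by lia) (by lia))
  refine IReg.regQuot_le (pow_ne_top_of_ne_top (sumIJ_ne_top hI1 hIh hJ1 hJh) (by lia)) h0 ?_
  have key := isSplit_inl_inr.iReg_pow_mul_add_pow isSplit_inr_inl I J (iReg_pow hI1 hIh)
    (iReg_pow hJ1 hJh) (n := n) (w := sSup V + 1) ?_ ?_ n 0 (by lia)
  · rwa [pow_zero, one_mul] at key
  · intro m t hmt
    split_ifs with hm ht ht
    · lia
    · have := hv2 m t hmt ht
      have := hI (m + 1) (by lia)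
      subst hm
      lia
    · have := hv2 (n - 1) 1 (by lia) one_ne_zero
      rw [show n - 1 + 1 = m by lia] at this
      have := hJ 1 one_ne_zero
      lia
    · have := hv1 m t hmt hm ht
      lia
  · intro m t hmt ht
    have := hv2 m t hmt (by lia)
    rw [if_neg (by lia), if_neg (by lia)]
    lia
end

section
/- For all n ≥ 1, depth (I+J)^n/(I+J)^{n+1} = min_{i+j=n, i,j ≥ 0} { depth I^i/I^{i+1} + depth J^j/J^{j+1} }, where I^i/I^{i+1} is regarded as an A-module and J^j/J^{j+1} as a B-module. -/
/-! Core definitions: depth via local cohomology at the maximal homogeneous ideal,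
Castelnuovo–Mumford regularity via graded free resolutions, gradings on
subquotients of polynomial rings.  -/

open MvPolynomial

section LocalCohomology

open CategoryTheory Limits Opposite

lemma ModuleCat.mono_homologyMap_of_forall {R : Type} [Ring R] {ι : Type*} {c : ComplexShape ι}
    {K L : HomologicalComplex (ModuleCat.{0} R) c} (f : K ⟶ L) (i j k : ι)
    (hi : c.prev j = i) (hk : c.next j = k)
    (h : ∀ x : K.X j, K.d j k x = 0 → ∀ y : L.X i, L.d i j y = f.f j x →
      ∃ y : K.X i, K.d i j y = x) :
    Mono (HomologicalComplex.homologyMap f j) := by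
  rw [HomologicalComplex.mono_homologyMap_iff_up_to_refinements f i j k hi hk]
  intro A x₂ hx₂ y₁ hy₁
  have key : ∀ a : A, x₂.hom a ∈ LinearMap.range (K.d i j).hom := fun a =>
    h _ (by simpa using congr($hx₂ a)) (y₁ a) (by simpa using congr($hy₁ a).symm)
  have hproj : Module.Projective R (Projective.over A : ModuleCat.{0} R) :=
    (IsProjective.iff_projective (R := R) (P := (Projective.over A : ModuleCat.{0} R))).mpr
      (inferInstanceAs (Projective (Projective.over A)))
  obtain ⟨l, hl⟩ := Module.projective_lifting_property (K.d i j).hom.rangeRestrict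
    ((x₂.hom.codRestrict _ key) ∘ₗ (Projective.π A).hom) (LinearMap.surjective_rangeRestrict _)
  refine ⟨_, Projective.π A, inferInstance, ModuleCat.ofHom l, ?_⟩
  ext a
  exact congr(($hl a).1).symm

lemma HomologicalComplex.epi_homologyMap_op {V : Type*} [Category* V] [Abelian V] {ι : Type*}
    {c : ComplexShape ι} {K L : HomologicalComplex V c} (f : K ⟶ L) (i : ι)
    [Mono (HomologicalComplex.homologyMap f i)] :
    Epi (HomologicalComplex.homologyMap ((HomologicalComplex.opFunctor _ _).map f.op) i) := by
  have e := HomologicalComplex.homologyOpNatIso V c i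
  have h : Epi ((HomologicalComplex.opFunctor V c ⋙
      HomologicalComplex.homologyFunctor Vᵒᵖ c.symm i).map f.op) := by
    have : Epi (((HomologicalComplex.homologyFunctor V c i).op).map f.op) :=
      inferInstanceAs (Epi (HomologicalComplex.homologyMap f i).op)
    rw [← NatIso.naturality_2 e]
    infer_instance
  exact h

lemma CategoryTheory.ProjectiveResolution.extMk_zero_eq_zero {R : Type} [CommRing R]
    {X Y : ModuleCat.{0} R} (P : ProjectiveResolution X) (f : P.complex.X 0 ⟶ Y)
    (hf : P.complex.d 1 0 ≫ f = 0)
    (h : P.extMk f 1 rfl hf = 0) : f = 0 := by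
  simp only [← P.extEquivCohomologyClass.apply_eq_iff_eq,
    extEquivCohomologyClass_extMk, extEquivCohomologyClass_zero,
    CochainComplex.HomComplex.CohomologyClass.mk_eq_zero_iff] at h
  rw [CochainComplex.HomComplex.Cocycle.toSingleMk_mem_coboundaries_iff _ _ _ _ _ 1 (by lia)] at h
  obtain ⟨g, hg⟩ := h
  rw [← cancel_epi (P.cochainComplexXIso (-(0 : ℕ)) 0 rfl).hom, comp_zero, ← hg]
  rw [show P.cochainComplex.d (-(0:ℕ)) 1 = 0 from
    (CochainComplex.isZero_of_isStrictlyLE _ 0 1 (by lia)).eq_of_tgt _ _, zero_comp]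

lemma mono_ext_map_of_mk₀_comp_injective {R : Type} [CommRing R] {X X' : ModuleCat.{0} R}
    (g : X' ⟶ X) (Y : ModuleCat.{0} R) (n : ℕ)
    (h : ∀ α : Abelian.Ext.{0} X Y n, (Abelian.Ext.mk₀ g).comp α (zero_add n) = 0 → α = 0) :
    Mono (((_root_.Ext R (ModuleCat.{0} R) n).map g.op).app Y) := by
  let P := projectiveResolution X
  let P' := projectiveResolution X'
  let φ : ProjectiveResolution.Hom P' P g :=
    ⟨ProjectiveResolution.lift g P' P, by
      simpa using ProjectiveResolution.lift_commutes_zero g P' P⟩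
  let F := ((linearYoneda R (ModuleCat.{0} R)).obj Y).rightOp
  change Mono ((F.leftDerived n).map g).unop
  suffices Epi ((F.leftDerived n).map g) by infer_instance
  have nat := ProjectiveResolution.isoLeftDerivedObj_hom_naturality g P' P φ.hom
    (by simpa using φ.hom_f_zero_comp_π_f_zero) F n
  suffices Epi ((F.mapHomologicalComplex _ ⋙ HomologicalComplex.homologyFunctor _ _ n).map φ.hom) by
    have h2 : Epi ((F.leftDerived n).map g ≫ (P.isoLeftDerivedObj F n).hom) := by
      rw [nat]; infer_instance
    rwa [epi_comp_iff_of_isIso] at h2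
  let ψ := (F.mapHomologicalComplex (ComplexShape.down ℕ)).map φ.hom
  let ψ' := (HomologicalComplex.unopFunctor _ _).map ψ.op
  suffices Mono (HomologicalComplex.homologyMap ψ' n) from
    HomologicalComplex.epi_homologyMap_op ψ' n
  cases n with
  | zero =>
    refine ModuleCat.mono_homologyMap_of_forall ψ' 0 0 1
      (show (ComplexShape.up ℕ).prev 0 = 0 by simp)
      (show (ComplexShape.up ℕ).next 0 = 1 by simp) ?_
    intro (x : P.complex.X 0 ⟶ Y) hx y hy
    have hx' : P.complex.d 1 0 ≫ x = 0 := hx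
    rw [HomologicalComplex.shape _ 0 0 (fun h ↦ by simp at h)] at hy
    have hy' : φ.hom.f 0 ≫ x = 0 := hy.symm
    refine ⟨0, ?_⟩
    have := h (P.extMk x 1 rfl hx') (by
      rw [ProjectiveResolution.mk₀_comp_extMk _ _ _ _ φ]
      simp [hy'])
    have := P.extMk_zero_eq_zero _ _ this
    subst this
    exact map_zero _
  | succ n =>
    refine ModuleCat.mono_homologyMap_of_forall ψ' n (n+1) (n+2)
      (show (ComplexShape.up ℕ).prev (n + 1) = n by simp)
      (show (ComplexShape.up ℕ).next (n + 1) = n + 2 by simp) ?_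
    intro (x : P.complex.X (n + 1) ⟶ Y) hx (y : P'.complex.X n ⟶ Y) hy
    have hx' : P.complex.d (n+2) (n+1) ≫ x = 0 := hx
    have hy' : P'.complex.d (n+1) n ≫ y = φ.hom.f (n+1) ≫ x := hy
    have := h (P.extMk x (n+2) rfl hx') (by
      rw [ProjectiveResolution.mk₀_comp_extMk _ _ _ _ φ]
      rw [ProjectiveResolution.extMk_eq_zero_iff _ _ _ _ _ _ rfl]
      exact ⟨y, hy'⟩)
    rw [ProjectiveResolution.extMk_eq_zero_iff _ _ _ _ _ _ rfl] at this
    exact this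

lemma isZero_ext_iff_subsingleton {R : Type} [CommRing R] {X : ModuleCat.{0} R}
    (Y : ModuleCat.{0} R) (n : ℕ) :
    IsZero (((_root_.Ext R (ModuleCat.{0} R) n).obj (op X)).obj Y) ↔
      Subsingleton (Abelian.Ext.{0} X Y n) := by
  let P := projectiveResolution X
  rw [(P.isoExt n Y).isZero_iff, ← HomologicalComplex.exactAt_iff_isZero_homology]
  cases n with
  | zero =>
    rw [HomologicalComplex.exactAt_iff' _ 0 0 1 (by simp) (by simp),
      ShortComplex.moduleCat_exact_iff]
    have hz : (P.complex.linearYonedaObj R Y).d 0 0 = 0 :=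
      HomologicalComplex.shape _ 0 0 (fun h ↦ by simp at h)
    refine ⟨fun h => subsingleton_of_forall_eq 0 fun α => ?_, fun h f hf => ?_⟩
    · obtain ⟨f, hf, rfl⟩ := P.extMk_surjective α 1 rfl
      obtain ⟨g, hg⟩ := h f hf
      have : f = 0 := hg.symm.trans congr($hz g)
      subst this
      simp
    · have : f = 0 := P.extMk_zero_eq_zero f hf (Subsingleton.elim _ _)
      exact ⟨0, by rw [this]; exact map_zero _⟩
  | succ n =>
    rw [HomologicalComplex.exactAt_iff' _ n (n + 1) (n + 2) (by simp) (by simp),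
      ShortComplex.moduleCat_exact_iff]
    refine ⟨fun h => subsingleton_of_forall_eq 0 fun α => ?_, fun h f hf => ?_⟩
    · obtain ⟨f, hf, rfl⟩ := P.extMk_surjective α (n + 2) rfl
      rw [P.extMk_eq_zero_iff _ _ _ _ _ rfl]
      exact h f hf
    · exact (P.extMk_eq_zero_iff f (n + 2) rfl hf _ rfl).mp (Subsingleton.elim _ _)

variable {R : Type} [CommRing R] (J : Ideal R)

lemma isZero_localCohomology_obj (M : ModuleCat.{0} R) (i : ℕ)
    (h : ∀ t : ℕ, Subsingleton (Abelian.Ext.{0} (ModuleCat.of R (R ⧸ J ^ t)) M i)) :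
    IsZero ((localCohomology J i).obj M) := by
  have e : (localCohomology J i).obj M ≅
      colimit (localCohomology.diagram (localCohomology.idealPowersDiagram J) i ⋙
        (evaluation _ _).obj M) :=
    colimitObjIsoColimitCompEvaluation _ _
  refine IsZero.of_iso ?_ e
  rw [IsZero.iff_id_eq_zero]
  refine colimit.hom_ext fun j => ?_
  refine IsZero.eq_of_src ?_ _ _
  exact (isZero_ext_iff_subsingleton M i).mpr (h _)

lemma nontrivial_localCohomology_obj (M : ModuleCat.{0} R) (i t₀ : ℕ)
    (h0 : ¬ Subsingleton (Abelian.Ext.{0} (ModuleCat.of R (R ⧸ J ^ t₀)) M i))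
    (h : ∀ (t : ℕ) (g : ModuleCat.of R (R ⧸ J ^ t) ⟶ ModuleCat.of R (R ⧸ J ^ t₀)),
      t₀ ≤ t → Function.Surjective g → ∀ α : Abelian.Ext.{0} _ M i,
        (Abelian.Ext.mk₀ g).comp α (zero_add i) = 0 → α = 0) :
    Nontrivial ((localCohomology J i).obj M) := by
  let D := localCohomology.diagram (localCohomology.idealPowersDiagram J) i ⋙ (evaluation _ _).obj M
  have e : (localCohomology J i).obj M ≅ colimit D :=
    colimitObjIsoColimitCompEvaluation _ _
  by_contra hn
  have : Subsingleton (colimit D : ModuleCat.{0} R) := by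
    rw [not_nontrivial_iff_subsingleton] at hn
    exact e.toLinearEquiv.symm.toEquiv.subsingleton
  have hs : Subsingleton (D.obj (op (op t₀))) := by
    refine subsingleton_of_forall_eq 0 fun x => ?_
    have hx : (colimit.ι D (op (op t₀))) x = (colimit.ι D (op (op t₀))) 0 := Subsingleton.elim _ _
    obtain ⟨k, f, g, hfg⟩ := (Concrete.colimit_rep_eq_iff_exists D x 0).mp hx
    have : Mono (D.map f) := by
      refine mono_ext_map_of_mk₀_comp_injective _ M i (h _ _ ?_ ?_)
      · exact f.unop.unop.le
      · exact Ideal.Quotient.factor_surjective (Ideal.pow_le_pow_right f.unop.unop.le)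
    rw [Subsingleton.elim g f] at hfg
    exact (ModuleCat.mono_iff_injective _).mp this hfg
  exact h0 ((isZero_ext_iff_subsingleton _ _).mp
    (ModuleCat.isZero_of_subsingleton (D.obj (op (op t₀)))))

end LocalCohomology

/-- A module `M` has depth `d` witnessed by a maximal `M`-regular sequence of elements of `𝔪`
followed by a nonzero element annihilated by `𝔪`. -/
inductive HasDepth {R : Type} [CommRing R] (𝔪 : Ideal R) :
    (M : Type) → [AddCommGroup M] → [Module R M] → ℕ → Prop
  | zero {M : Type} [AddCommGroup M] [Module R M] (m : M) (hm : m ≠ 0)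
      (h : ∀ x ∈ 𝔪, x • m = 0) : HasDepth 𝔪 M 0
  | succ {M N : Type} [AddCommGroup M] [Module R M] [AddCommGroup N] [Module R N] {d : ℕ}
      (x : R) (hx : x ∈ 𝔪) (hreg : IsSMulRegular M x) (f : M →ₗ[R] N)
      (hf : Function.Surjective f) (hker : ∀ m, f m = 0 ↔ ∃ m', x • m' = m)
      (h : HasDepth 𝔪 N d) : HasDepth 𝔪 M (d + 1)

section ExtDepth

open CategoryTheory Limits Opposite

variable {R : Type} [CommRing R]

/-- `Ext`-theoretic depth. -/
def ExtDepth (𝔪 : Ideal R) (M : ModuleCat.{0} R) (d : ℕ) : Prop :=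
  (∀ i < d, ∀ (N : ModuleCat.{0} R) (t : ℕ), 𝔪 ^ t ≤ Module.annihilator R N →
    Subsingleton (Abelian.Ext.{0} N M i)) ∧
  ¬ Subsingleton (Abelian.Ext.{0} (ModuleCat.of R (R ⧸ 𝔪 ^ 1)) M d)

lemma subsingleton_ext_of_isSMulRegular {N M : ModuleCat.{0} R} {x : R} {t i : ℕ}
    (hx : x ^ t ∈ Module.annihilator R N) (h : IsSMulRegular (Abelian.Ext.{0} N M i) x) :
    Subsingleton (Abelian.Ext.{0} N M i) := by
  refine subsingleton_of_forall_eq 0 fun α => (h.pow t) ?_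
  have h0 := congr($(Abelian.Ext.postcomp_smul_id_eq_zero_of_mem_annihilator
    (M := M) hx i) α)
  simpa [Abelian.Ext.mk₀_smul] using h0

lemma extDepth_zero {𝔪 : Ideal R} {M : Type} [AddCommGroup M] [Module R M]
    (m : M) (hm : m ≠ 0) (h : ∀ x ∈ 𝔪, x • m = 0) : ExtDepth 𝔪 (ModuleCat.of R M) 0 := by
  refine ⟨fun i hi => absurd hi (Nat.not_lt_zero i), fun hs => hm ?_⟩
  have : Subsingleton (ModuleCat.of R (R ⧸ 𝔪 ^ 1) ⟶ ModuleCat.of R M) :=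
    Abelian.Ext.addEquiv₀.symm.subsingleton
  let φ : (R ⧸ 𝔪 ^ 1) →ₗ[R] M :=
    Submodule.liftQ _ (LinearMap.toSpanSingleton R M m) (by
      intro x hx
      rw [pow_one] at hx
      simpa using h x hx)
  have h1 : φ (Submodule.Quotient.mk (1 : R)) = 0 :=
    congr($(Subsingleton.elim (ModuleCat.ofHom φ) 0) (Submodule.Quotient.mk (1 : R)))
  rwa [Submodule.liftQ_apply, LinearMap.toSpanSingleton_apply, one_smul] at h1

lemma extDepth_succ {𝔪 : Ideal R} {M N : Type} [AddCommGroup M] [Module R M]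
    [AddCommGroup N] [Module R N] {d : ℕ}
    (x : R) (hx : x ∈ 𝔪) (hreg : IsSMulRegular M x) (f : M →ₗ[R] N)
    (hf : Function.Surjective f) (hker : ∀ m, f m = 0 ↔ ∃ m', x • m' = m)
    (h : ExtDepth 𝔪 (ModuleCat.of R N) d) : ExtDepth 𝔪 (ModuleCat.of R M) (d + 1) := by
  let S : ShortComplex (ModuleCat.{0} R) := ShortComplex.mk
    (x • 𝟙 (ModuleCat.of R M)) (ModuleCat.ofHom f) (by
      ext m
      simpa using (hker (x • m)).mpr ⟨m, rfl⟩)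
  have hS : S.ShortExact := by
    refine ModuleCat.shortComplex_shortExact S ?_ ?_ hf
    · intro m
      exact (hker m)
    · intro a b hab
      exact hreg hab
  have hdelta : ∀ (L : ModuleCat.{0} R) (i : ℕ) (α : Abelian.Ext.{0} L (ModuleCat.of R M) (i + 1)),
      x • α = 0 → ∃ β : Abelian.Ext.{0} L (ModuleCat.of R N) i, β.comp hS.extClass rfl = α := by
    intro L i α hα
    refine Abelian.Ext.covariant_sequence_exact₁ L hS α ?_ rfl
    change α.comp (Abelian.Ext.mk₀ (x • 𝟙 (ModuleCat.of R M))) (add_zero (i + 1)) = 0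
    rw [Abelian.Ext.mk₀_smul, Abelian.Ext.comp_smul, Abelian.Ext.comp_mk₀_id, hα]
  have hvan : ∀ i < d + 1, ∀ (L : ModuleCat.{0} R) (t : ℕ), 𝔪 ^ t ≤ Module.annihilator R L →
      Subsingleton (Abelian.Ext.{0} L (ModuleCat.of R M) i) := by
    intro i hi L t ht
    refine subsingleton_ext_of_isSMulRegular (ht (Ideal.pow_mem_pow hx t)) ?_
    rw [isSMulRegular_iff_right_eq_zero_of_smul]
    cases i with
    | zero =>
      intro α hα
      obtain ⟨g, rfl⟩ := Abelian.Ext.addEquiv₀.symm.surjective α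
      rw [Abelian.Ext.addEquiv₀_symm_apply, ← Abelian.Ext.mk₀_smul,
        Abelian.Ext.mk₀_eq_zero_iff] at hα
      rw [Abelian.Ext.addEquiv₀_symm_apply, Abelian.Ext.mk₀_eq_zero_iff]
      ext y
      exact hreg (by simpa using congr($hα y))
    | succ i =>
      intro α hα
      obtain ⟨β, rfl⟩ := hdelta L i α hα
      have := h.1 i (by omega) L t ht
      rw [Subsingleton.elim β 0, Abelian.Ext.zero_comp]
  refine ⟨hvan, fun hs => h.2 (subsingleton_of_forall_eq 0 fun β => ?_)⟩
  obtain ⟨γ, rfl⟩ := Abelian.Ext.covariant_sequence_exact₃ _ hS β rfl (Subsingleton.elim _ _)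
  have := hvan d (by omega) (ModuleCat.of R (R ⧸ 𝔪 ^ 1)) 1
    (by rw [Ideal.annihilator_quotient])
  rw [Subsingleton.elim γ 0, Abelian.Ext.zero_comp]

lemma HasDepth.extDepth {𝔪 : Ideal R} {M : Type} [AddCommGroup M] [Module R M] {d : ℕ}
    (h : HasDepth 𝔪 M d) : ExtDepth 𝔪 (ModuleCat.of R M) d := by
  induction h with
  | zero m hm h => exact extDepth_zero m hm h
  | succ x hx hreg f hf hker _ ih => exact extDepth_succ x hx hreg f hf hker ih

lemma ExtDepth.mk₀_comp_injective {𝔪 : Ideal R} {M : ModuleCat.{0} R} {d : ℕ}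
    (h : ExtDepth 𝔪 M d) {X Y : ModuleCat.{0} R} (g : X ⟶ Y) (hg : Function.Surjective g)
    {t : ℕ} (ht : 𝔪 ^ t ≤ Module.annihilator R X) (α : Abelian.Ext.{0} Y M d)
    (hα : (Abelian.Ext.mk₀ g).comp α (zero_add d) = 0) : α = 0 := by
  cases d with
  | zero =>
    obtain ⟨u, rfl⟩ := Abelian.Ext.addEquiv₀.symm.surjective α
    have := (ModuleCat.epi_iff_surjective g).mpr hg
    rw [Abelian.Ext.addEquiv₀_symm_apply, Abelian.Ext.mk₀_comp_mk₀,
      Abelian.Ext.mk₀_eq_zero_iff] at hα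
    rw [Abelian.Ext.addEquiv₀_symm_apply, Abelian.Ext.mk₀_eq_zero_iff]
    exact zero_of_epi_comp g hα
  | succ d =>
    have hS := LinearMap.shortExact_shortComplexKer (f := g.hom) hg
    obtain ⟨β, rfl⟩ := Abelian.Ext.contravariant_sequence_exact₃ hS M α hα (add_comm 1 d)
    have := h.1 d (by omega) (g.hom.shortComplexKer).X₁ t (ht.trans
      (LinearMap.annihilator_le_of_injective (LinearMap.ker g.hom).subtype
        (Submodule.subtype_injective _)))
    rw [Subsingleton.elim β 0, Abelian.Ext.comp_zero]

lemma ExtDepth.subsingleton_localCohomology {𝔪 : Ideal R} {M : ModuleCat.{0} R} {d : ℕ}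
    (h : ExtDepth 𝔪 M d) {i : ℕ} (hi : i < d) :
    Subsingleton ((localCohomology 𝔪 i).obj M) :=
  ModuleCat.subsingleton_of_isZero (isZero_localCohomology_obj 𝔪 M i fun t =>
    h.1 i hi _ t (by rw [Ideal.annihilator_quotient]))

lemma ExtDepth.nontrivial_localCohomology {𝔪 : Ideal R} {M : ModuleCat.{0} R} {d : ℕ}
    (h : ExtDepth 𝔪 M d) : Nontrivial ((localCohomology 𝔪 d).obj M) :=
  nontrivial_localCohomology_obj 𝔪 M d 1 h.2 fun t g _ hg α hα =>
    h.mk₀_comp_injective g hg (t := t) (by rw [Ideal.annihilator_quotient]) α hα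

lemma ExtDepth.sInf_eq {𝔪 : Ideal R} {M : ModuleCat.{0} R} {d : ℕ} (h : ExtDepth 𝔪 M d) :
    sInf {i : ℕ | Nontrivial ((localCohomology 𝔪 i).obj M)} = d := by
  refine le_antisymm (Nat.sInf_le h.nontrivial_localCohomology)
    (le_csInf ⟨d, h.nontrivial_localCohomology⟩ fun i hi => ?_)
  by_contra hlt
  exact not_subsingleton_iff_nontrivial.mpr hi (h.subsingleton_localCohomology (not_le.mp hlt))

lemma extDepth_of_sum_eq_id {𝔪 : Ideal R} {ι : Type} [Fintype ι] {T : ι → ModuleCat.{0} R}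
    {M : ModuleCat.{0} R} (f : ∀ i, T i ⟶ M) (p : ∀ i, M ⟶ T i)
    (hfp : ∀ i, f i ≫ p i = 𝟙 _) (hpf : ∑ i, p i ≫ f i = 𝟙 M) {d : ι → ℕ}
    (h : ∀ i, ExtDepth 𝔪 (T i) (d i)) (i₀ : ι) (hi₀ : ∀ i, d i₀ ≤ d i) :
    ExtDepth 𝔪 M (d i₀) := by
  refine ⟨fun j hj N t ht => subsingleton_of_forall_eq 0 fun α => ?_,
    fun hs => (h i₀).2 (subsingleton_of_forall_eq 0 fun α => ?_)⟩
  · have : α = α.comp (Abelian.Ext.mk₀ (𝟙 M)) (add_zero j) := by simp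
    rw [this, ← hpf, Abelian.Ext.mk₀_sum, Abelian.Ext.comp_sum]
    refine Finset.sum_eq_zero fun i _ => ?_
    have := (h i).1 j (hj.trans_le (hi₀ i)) N t ht
    rw [← Abelian.Ext.mk₀_comp_mk₀, ← Abelian.Ext.comp_assoc_of_second_deg_zero,
      Subsingleton.elim (α.comp (Abelian.Ext.mk₀ (p i)) (add_zero j)) 0, Abelian.Ext.zero_comp]
  · have : α = α.comp (Abelian.Ext.mk₀ (𝟙 (T i₀))) (add_zero _) := by simp
    rw [this, ← hfp, ← Abelian.Ext.mk₀_comp_mk₀, ← Abelian.Ext.comp_assoc_of_second_deg_zero,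
      Subsingleton.elim (α.comp (Abelian.Ext.mk₀ (f i₀)) (add_zero _)) 0, Abelian.Ext.zero_comp]

end ExtDepth

section Existence

open scoped Pointwise

variable {R : Type} [CommRing R]

lemma exists_hasDepth [IsNoetherianRing R] (𝔪 : Ideal R) (M : Type) [AddCommGroup M] [Module R M]
    [Module.Finite R M] (hM : 𝔪 • (⊤ : Submodule R M) ≠ ⊤) : ∃ d, HasDepth 𝔪 M d := by
  induction h : Module.annihilator R M using WellFoundedGT.induction generalizing M with
  | ind 𝔞 ih =>
  subst h
  by_cases hs : Subsingleton ((R ⧸ 𝔪) →ₗ[R] M)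
  · obtain ⟨x, hx, hreg⟩ := IsSMulRegular.subsingleton_linearMap_iff.mp hs
    rw [Ideal.annihilator_quotient] at hx
    have hx_mem (m : M) : m ∈ x • (⊤ : Submodule R M) ↔ ∃ m₁, x • m₁ = m := by
      simp [Submodule.mem_smul_pointwise_iff_exists]
    have hlt : Module.annihilator R M < Module.annihilator R (QuotSMulTop x M) := by
      refine lt_of_le_of_ne (LinearMap.annihilator_le_of_surjective
        (Submodule.mkQ _) (Submodule.mkQ_surjective _)) fun heq => hM ?_
      have hxM : x ∈ Module.annihilator R M := by
        rw [heq, Module.mem_annihilator]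
        intro m
        obtain ⟨m, rfl⟩ := Submodule.mkQ_surjective _ m
        rw [← map_smul, Submodule.mkQ_apply, Submodule.Quotient.mk_eq_zero, hx_mem]
        exact ⟨m, rfl⟩
      have : Subsingleton M := subsingleton_of_forall_eq 0 fun m => hreg <| by
        simp [Module.mem_annihilator.mp hxM m]
      exact Subsingleton.elim _ _
    have hN : 𝔪 • (⊤ : Submodule R (QuotSMulTop x M)) ≠ ⊤ := by
      intro h
      have h1 := congr(Submodule.comap (Submodule.mkQ _) $h)
      rw [Submodule.comap_smul_top_of_surjective _ _ (Submodule.mkQ_surjective _),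
        Submodule.ker_mkQ, Submodule.comap_top, sup_eq_left.mpr] at h1
      · exact hM h1
      · rw [← Submodule.ideal_span_singleton_smul]
        exact Submodule.smul_mono_left ((Ideal.span_singleton_le_iff_mem _).mpr hx)
    obtain ⟨d, hd⟩ := ih _ hlt (QuotSMulTop x M) hN rfl
    exact ⟨d + 1, .succ x hx hreg (Submodule.mkQ _) (Submodule.mkQ_surjective _)
      (fun m => by rw [Submodule.mkQ_apply, Submodule.Quotient.mk_eq_zero, hx_mem]) hd⟩
  · rw [not_subsingleton_iff_nontrivial] at hs
    obtain ⟨φ, hφ⟩ := exists_ne (0 : (R ⧸ 𝔪) →ₗ[R] M)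
    refine ⟨0, .zero (φ 1) (fun h0 => hφ ?_) fun x hx => ?_⟩
    · ext
      simpa using h0
    · rw [← map_smul, Algebra.smul_def, mul_one, Ideal.Quotient.algebraMap_eq,
        Ideal.Quotient.eq_zero_iff_mem.mpr hx, map_zero]

lemma smul_top_ne_top_of_subQuot [IsNoetherianRing R] [IsDomain R] {𝔪 I : Ideal R}
    (h𝔪 : 𝔪 ≠ ⊤) (hI : I ≤ 𝔪) (hI0 : I ≠ ⊥) (i : ℕ) :
    𝔪 • (⊤ : Submodule R (↥(I ^ i) ⧸ Submodule.comap (I ^ i).subtype (I ^ (i + 1)))) ≠ ⊤ := by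
  intro h
  have h1 : I ^ i ≤ 𝔪 * I ^ i := by
    intro f hf
    have := congr(Submodule.map (I ^ i).subtype (Submodule.comap (Submodule.mkQ _) $h))
    rw [Submodule.comap_smul_top_of_surjective _ _ (Submodule.mkQ_surjective _)] at this
    have hf' : f ∈ Submodule.map (I ^ i).subtype (Submodule.comap (Submodule.mkQ
      (Submodule.comap (I ^ i).subtype (I ^ (i + 1)))) ⊤) := ⟨⟨f, hf⟩, trivial, rfl⟩
    rw [← this, Submodule.map_sup, Submodule.ker_mkQ, Submodule.map_smul''] at hf'
    rw [Submodule.map_top, Submodule.range_subtype, Submodule.map_comap_subtype] at hf'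
    refine (sup_le ?_ ?_ : _ ≤ 𝔪 * I ^ i) hf'
    · exact le_rfl
    · refine inf_le_right.trans ?_
      rw [pow_succ']
      exact Ideal.mul_mono_left hI
  obtain ⟨r, hr, hr0⟩ := Submodule.exists_sub_one_mem_and_smul_eq_zero_of_fg_of_le_smul 𝔪 (I ^ i)
    (IsNoetherian.noetherian _) h1
  obtain ⟨f, hf, hf0⟩ := Submodule.exists_mem_ne_zero_of_ne_bot (pow_ne_zero i hI0)
  have := hr0 f hf
  rw [smul_eq_mul, mul_eq_zero, or_iff_left hf0] at this
  subst this
  exact h𝔪 ((Ideal.eq_top_iff_one _).mpr (by simpa using hr))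

end Existence

section ExternalTensor

open TensorProduct PaperHTT

lemma forall_smul_eq_zero_of_mem_maxHomIdeal {k σ M : Type} [Field k] [AddCommGroup M]
    [Module (MvPolynomial σ k) M] {m : M} (h : ∀ i, (X i : MvPolynomial σ k) • m = 0) :
    ∀ x ∈ maxHomIdeal k σ, x • m = 0 := by
  have : maxHomIdeal k σ ≤ LinearMap.ker (LinearMap.toSpanSingleton (MvPolynomial σ k) M m) := by
    rw [maxHomIdeal, Ideal.span_le]
    rintro _ ⟨i, rfl⟩
    exact h i
  exact fun x hx => this hx

lemma rename_mem_maxHomIdeal {k σ τ : Type} [Field k] (f : σ → τ) {x : MvPolynomial σ k}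
    (hx : x ∈ maxHomIdeal k σ) : rename f x ∈ maxHomIdeal k τ := by
  have : maxHomIdeal k σ ≤ (maxHomIdeal k τ).comap (rename f) := by
    rw [maxHomIdeal, Ideal.span_le]
    rintro _ ⟨i, rfl⟩
    rw [SetLike.mem_coe, Ideal.mem_comap, rename_X]
    exact Ideal.subset_span (Set.mem_range_self (f i))
  exact this hx

lemma tmul_ne_zero_of_field {k M N : Type} [Field k] [AddCommGroup M] [Module k M]
    [AddCommGroup N] [Module k N] {m : M} {n : N} (hm : m ≠ 0) (hn : n ≠ 0) :
    m ⊗ₜ[k] n ≠ 0 := by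
  intro h
  rw [ne_eq, ← Module.forall_dual_apply_eq_zero_iff k] at hm hn
  push Not at hm hn
  obtain ⟨φ, hφ⟩ := hm
  obtain ⟨ψ, hψ⟩ := hn
  have h1 := congr(TensorProduct.lid k k (TensorProduct.map φ ψ $h))
  simp [hφ, hψ] at h1

variable {k σ τ : Type} [Field k]

/-- An additive map commuting with both families of variables is linear. -/
lemma map_smul_of_map_rename_smul {T T' : Type} [AddCommGroup T] [AddCommGroup T']
    [Module (MvPolynomial (σ ⊕ τ) k) T] [Module (MvPolynomial (σ ⊕ τ) k) T'] (f : T →+ T')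
    (hl : ∀ (a : MvPolynomial σ k) (t : T),
      f (rename (Sum.inl : σ → σ ⊕ τ) a • t) = rename (Sum.inl : σ → σ ⊕ τ) a • f t)
    (hr : ∀ (b : MvPolynomial τ k) (t : T),
      f (rename (Sum.inr : τ → σ ⊕ τ) b • t) = rename (Sum.inr : τ → σ ⊕ τ) b • f t)
    (p : MvPolynomial (σ ⊕ τ) k) (t : T) : f (p • t) = p • f t := by
  induction p using MvPolynomial.induction_on generalizing t with
  | C a => simpa using hl (C a) t
  | add p q hp hq => rw [add_smul, map_add, hp, hq, add_smul]
  | mul_X p i hp =>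
    rw [mul_smul, mul_smul, hp]
    congr 1
    cases i with
    | inl i => simpa using hl (X i) t
    | inr i => simpa using hr (X i) t

variable (k) in
/-- The identification of `k[x, y]` with `k[x] ⊗ k[y]`, in one direction. -/
noncomputable def sumToTensor (σ τ : Type) :
    MvPolynomial (σ ⊕ τ) k →ₐ[k] MvPolynomial σ k ⊗[k] MvPolynomial τ k :=
  aeval (Sum.elim (fun i => X i ⊗ₜ 1) (fun j => 1 ⊗ₜ X j))

lemma sumToTensor_rename_inl (a : MvPolynomial σ k) :
    sumToTensor k σ τ (rename Sum.inl a) = a ⊗ₜ 1 := by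
  have : (sumToTensor k σ τ).comp (rename Sum.inl) = Algebra.TensorProduct.includeLeft := by
    ext i
    simp [sumToTensor]
  exact congr($this a)

lemma sumToTensor_rename_inr (b : MvPolynomial τ k) :
    sumToTensor k σ τ (rename Sum.inr b) = 1 ⊗ₜ b := by
  have : (sumToTensor k σ τ).comp (rename Sum.inr) = Algebra.TensorProduct.includeRight := by
    ext i
    simp [sumToTensor]
  exact congr($this b)

variable {M : Type} [AddCommGroup M] [Module (MvPolynomial σ k) M] [Module k M]
  [IsScalarTower k (MvPolynomial σ k) M]
  {N : Type} [AddCommGroup N] [Module (MvPolynomial τ k) N] [Module k N]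
  [IsScalarTower k (MvPolynomial τ k) N]

/-- The `k[x, y]`-module structure on the tensor product over `k` of a `k[x]`-module and a
`k[y]`-module. -/
@[reducible]
noncomputable def externalTensorModule : Module (MvPolynomial (σ ⊕ τ) k) (M ⊗[k] N) :=
  Module.compHom (M ⊗[k] N)
    (((Module.endTensorEndAlgHom (R := k) (S := k) (A := k) (M := M) (N := N)).comp
      (Algebra.TensorProduct.map (Algebra.lsmul k k M) (Algebra.lsmul k k N))).comp
      (sumToTensor k σ τ)).toRingHom

attribute [local instance] externalTensorModule

lemma rename_inl_smul_tmul (a : MvPolynomial σ k) (m : M) (n : N) :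
    rename (Sum.inl : σ → σ ⊕ τ) a • (m ⊗ₜ[k] n) = (a • m) ⊗ₜ[k] n := by
  change Module.endTensorEndAlgHom (Algebra.TensorProduct.map (Algebra.lsmul k k M)
    (Algebra.lsmul k k N) (sumToTensor k σ τ (rename Sum.inl a))) (m ⊗ₜ[k] n) = _
  rw [sumToTensor_rename_inl, Algebra.TensorProduct.map_tmul, Module.endTensorEndAlgHom_apply]
  simp

lemma rename_inr_smul_tmul (b : MvPolynomial τ k) (m : M) (n : N) :
    rename (Sum.inr : τ → σ ⊕ τ) b • (m ⊗ₜ[k] n) = m ⊗ₜ[k] (b • n) := by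
  change Module.endTensorEndAlgHom (Algebra.TensorProduct.map (Algebra.lsmul k k M)
    (Algebra.lsmul k k N) (sumToTensor k σ τ (rename Sum.inr b))) (m ⊗ₜ[k] n) = _
  rw [sumToTensor_rename_inr, Algebra.TensorProduct.map_tmul, Module.endTensorEndAlgHom_apply]
  simp

lemma rename_inl_smul_eq (a : MvPolynomial σ k) (t : M ⊗[k] N) :
    rename (Sum.inl : σ → σ ⊕ τ) a • t = (Algebra.lsmul k k M a).rTensor N t := by
  induction t with
  | zero => simp
  | add x y hx hy => rw [smul_add, hx, hy, map_add]
  | tmul m n => simp [rename_inl_smul_tmul]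

lemma rename_inr_smul_eq (b : MvPolynomial τ k) (t : M ⊗[k] N) :
    rename (Sum.inr : τ → σ ⊕ τ) b • t = (Algebra.lsmul k k N b).lTensor M t := by
  induction t with
  | zero => simp
  | add x y hx hy => rw [smul_add, hx, hy, map_add]
  | tmul m n => simp [rename_inr_smul_tmul]

variable {M' : Type} [AddCommGroup M'] [Module (MvPolynomial σ k) M'] [Module k M']
  [IsScalarTower k (MvPolynomial σ k) M']
  {N' : Type} [AddCommGroup N'] [Module (MvPolynomial τ k) N'] [Module k N']
  [IsScalarTower k (MvPolynomial τ k) N']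

/-- Functoriality of the external tensor product. -/
noncomputable def externalMap (f : M →ₗ[MvPolynomial σ k] M') (g : N →ₗ[MvPolynomial τ k] N') :
    M ⊗[k] N →ₗ[MvPolynomial (σ ⊕ τ) k] M' ⊗[k] N' where
  toFun := TensorProduct.map (f.restrictScalars k) (g.restrictScalars k)
  map_add' := map_add _
  map_smul' := map_smul_of_map_rename_smul
    (TensorProduct.map (f.restrictScalars k) (g.restrictScalars k)).toAddMonoidHom
    (fun a t => by
      induction t with
      | zero => simp
      | add x y hx hy => rw [smul_add, map_add, hx, hy, map_add, smul_add]
      | tmul m n => simp [rename_inl_smul_tmul])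
    (fun b t => by
      induction t with
      | zero => simp
      | add x y hx hy => rw [smul_add, map_add, hx, hy, map_add, smul_add]
      | tmul m n => simp [rename_inr_smul_tmul])

omit [Module k N] [IsScalarTower k (MvPolynomial τ k) N] in
lemma HasDepth.tensor_socle {m : M} (hm : m ≠ 0) (hm' : ∀ x ∈ maxHomIdeal k σ, x • m = 0)
    {b : ℕ} (hN : HasDepth (maxHomIdeal k τ) N b) :
    ∀ [Module k N] [IsScalarTower k (MvPolynomial τ k) N],
      HasDepth (maxHomIdeal k (σ ⊕ τ)) (M ⊗[k] N) b := by
  generalize h : maxHomIdeal k τ = 𝔫 at hN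
  induction hN with
  | zero n hn hn' =>
    subst h
    intro _ _
    refine .zero (m ⊗ₜ n) (tmul_ne_zero_of_field hm hn)
      (forall_smul_eq_zero_of_mem_maxHomIdeal fun i => ?_)
    rcases i with i | j
    · rw [← rename_X, rename_inl_smul_tmul, hm' _ (Ideal.subset_span ⟨i, rfl⟩), zero_tmul]
    · rw [← rename_X, rename_inr_smul_tmul, hn' _ (Ideal.subset_span ⟨j, rfl⟩), tmul_zero]
  | @succ N N' _ _ _ _ d x hx hreg f hf hker _ ih =>
    subst h
    intro _ _
    let : Module k N' := Module.compHom N' (algebraMap k (MvPolynomial τ k))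
    have : IsScalarTower k (MvPolynomial τ k) N' := ⟨fun a b n => by
      rw [Algebra.smul_def, mul_smul]; rfl⟩
    refine .succ (rename Sum.inr x) (rename_mem_maxHomIdeal _ hx) ?_
      (externalMap LinearMap.id f) (LinearMap.lTensor_surjective M hf) ?_ ih
    · intro t t' htt
      simp only [rename_inr_smul_eq] at htt
      exact Module.Flat.lTensor_preserves_injective_linearMap (Algebra.lsmul k k N x) hreg htt
    · intro t
      simp only [rename_inr_smul_eq]
      exact lTensor_exact M (f := Algebra.lsmul k k N x) (g := f.restrictScalars k) hker hf t

omit [Module k M] [IsScalarTower k (MvPolynomial σ k) M] in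
theorem HasDepth.tensor {a b : ℕ} (hM : HasDepth (maxHomIdeal k σ) M a)
    (hN : HasDepth (maxHomIdeal k τ) N b) :
    ∀ [Module k M] [IsScalarTower k (MvPolynomial σ k) M],
      HasDepth (maxHomIdeal k (σ ⊕ τ)) (M ⊗[k] N) (a + b) := by
  generalize h : maxHomIdeal k σ = 𝔪 at hM
  induction hM with
  | zero m hm hm' =>
    subst h
    intro _ _
    rw [zero_add]
    exact hN.tensor_socle hm hm'
  | @succ M M' _ _ _ _ d x hx hreg f hf hker _ ih =>
    subst h
    intro _ _
    let : Module k M' := Module.compHom M' (algebraMap k (MvPolynomial σ k))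
    have : IsScalarTower k (MvPolynomial σ k) M' := ⟨fun a b n => by
      rw [Algebra.smul_def, mul_smul]; rfl⟩
    rw [add_right_comm]
    refine .succ (rename Sum.inl x) (rename_mem_maxHomIdeal _ hx) ?_
      (externalMap f LinearMap.id) (LinearMap.rTensor_surjective N hf) ?_ ih
    · intro t t' htt
      simp only [rename_inl_smul_eq] at htt
      exact Module.Flat.rTensor_preserves_injective_linearMap (Algebra.lsmul k k M x) hreg htt
    · intro t
      simp only [rename_inl_smul_eq]
      exact rTensor_exact N (f := Algebra.lsmul k k M x) (g := f.restrictScalars k) hker hf t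

end ExternalTensor

section SumPow

open TensorProduct PaperHTT

attribute [local instance] externalTensorModule

variable {k σ τ : Type} [Field k]

lemma Ideal.add_pow_le_iSup {S : Type*} [CommRing S] (a b : Ideal S) (n : ℕ) :
    (a + b) ^ n ≤ ⨆ ij : {ij : ℕ × ℕ // ij.1 + ij.2 = n}, a ^ ij.1.1 * b ^ ij.1.2 := by
  rw [add_pow, Ideal.sum_eq_sup, Finset.sup_le_iff]
  intro i hi
  refine le_trans ?_ (le_iSup _ (⟨(i, n - i), ?_⟩ : {ij : ℕ × ℕ // ij.1 + ij.2 = n}))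
  · exact Ideal.mul_le_left
  · have := Finset.mem_range.mp hi
    simp only
    omega

lemma sum_pow_induction {I : Ideal (MvPolynomial σ k)} {J : Ideal (MvPolynomial τ k)} {n : ℕ}
    {P : MvPolynomial (σ ⊕ τ) k → Prop} (h0 : P 0) (hadd : ∀ f g, P f → P g → P (f + g))
    (hmul : ∀ i j, i + j = n → ∀ u ∈ I ^ i, ∀ v ∈ J ^ j,
      P (rename Sum.inl u * rename Sum.inr v))
    {f : MvPolynomial (σ ⊕ τ) k}
    (hf : f ∈ (I.map (rename (Sum.inl : σ → σ ⊕ τ)) + J.map (rename (Sum.inr : τ → σ ⊕ τ))) ^ n) :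
    P f := by
  have key : ∀ i j, i + j = n → ∀ c, ∀ u ∈ I ^ i, ∀ v ∈ J ^ j,
      P (c * (rename Sum.inl u * rename Sum.inr v)) := by
    intro i j hij c
    induction c using MvPolynomial.induction_on with
    | C a =>
      intro u hu v hv
      have := hmul i j hij (C a * u) (Ideal.mul_mem_left _ _ hu) v hv
      rwa [map_mul, rename_C, mul_assoc] at this
    | add p q hp hq =>
      intro u hu v hv
      rw [add_mul]
      exact hadd _ _ (hp u hu v hv) (hq u hu v hv)
    | mul_X p x hp =>
      intro u hu v hv
      rcases x with x | x
      · have := hp (X x * u) (Ideal.mul_mem_left _ _ hu) v hv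
        rw [map_mul, rename_X] at this
        convert this using 1
        ring
      · have := hp u hu (X x * v) (Ideal.mul_mem_left _ _ hv)
        rw [map_mul, rename_X] at this
        convert this using 1
        ring
  refine Submodule.iSup_induction (fun ij : {ij : ℕ × ℕ // ij.1 + ij.2 = n} =>
    I.map (rename (Sum.inl : σ → σ ⊕ τ)) ^ ij.1.1 * J.map (rename (Sum.inr : τ → σ ⊕ τ)) ^ ij.1.2)
    (motive := P) (Ideal.add_pow_le_iSup _ _ n hf) (fun ij g hg => ?_) h0 hadd
  rw [← Ideal.map_pow, ← Ideal.map_pow, Ideal.map, Ideal.map, Ideal.span_mul_span'] at hg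
  suffices ∀ c, P (c * g) by simpa using this 1
  induction hg using Submodule.span_induction with
  | mem x hx =>
    obtain ⟨_, ⟨u, hu, rfl⟩, _, ⟨v, hv, rfl⟩, rfl⟩ := hx
    exact fun c => key _ _ ij.2 c u hu v hv
  | zero => simpa using h0
  | add x y _ _ hx hy => exact fun c => by rw [mul_add]; exact hadd _ _ (hx c) (hy c)
  | smul d x _ hx => exact fun c => by rw [smul_eq_mul, ← mul_assoc]; exact hx _

lemma exists_extension_and_section {p : Ideal (MvPolynomial σ k)} {M : Type} [AddCommGroup M]
    [Module (MvPolynomial σ k) M] [Module k M] [IsScalarTower k (MvPolynomial σ k) M]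
    (f : p →ₗ[MvPolynomial σ k] M) (hf : Function.Surjective f) :
    ∃ π : MvPolynomial σ k →ₗ[k] M, ∃ s : M →ₗ[k] MvPolynomial σ k,
      (∀ u (hu : u ∈ p), π u = f ⟨u, hu⟩) ∧ (∀ m, s m ∈ p) ∧ ∀ m, π (s m) = m := by
  obtain ⟨g, hg⟩ := (p.subtype.restrictScalars k).exists_leftInverse_of_injective
    (LinearMap.ker_eq_bot.mpr p.injective_subtype)
  obtain ⟨s, hs⟩ := (f.restrictScalars k).exists_rightInverse_of_surjective
    (LinearMap.range_eq_top.mpr hf)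
  have hπ : ∀ u (hu : u ∈ p), (f.restrictScalars k ∘ₗ g) u = f ⟨u, hu⟩ :=
    fun u hu => congr(f ($hg ⟨u, hu⟩))
  exact ⟨f.restrictScalars k ∘ₗ g, p.subtype.restrictScalars k ∘ₗ s, hπ, fun m => (s m).2,
    fun m => (hπ _ (s m).2).trans congr($hs m)⟩

variable {M : ℕ → Type} [∀ i, AddCommGroup (M i)] [∀ i, Module (MvPolynomial σ k) (M i)]
  [∀ i, Module k (M i)] [∀ i, IsScalarTower k (MvPolynomial σ k) (M i)]
  {N : ℕ → Type} [∀ j, AddCommGroup (N j)] [∀ j, Module (MvPolynomial τ k) (N j)]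
  [∀ j, Module k (N j)] [∀ j, IsScalarTower k (MvPolynomial τ k) (N j)]

theorem nonempty_linearEquiv_subQuot_sum_pow {I : Ideal (MvPolynomial σ k)}
    {J : Ideal (MvPolynomial τ k)} (n : ℕ) {Q : Ideal (MvPolynomial (σ ⊕ τ) k)}
    (hQ : Q = I.map (rename (Sum.inl : σ → σ ⊕ τ)) + J.map (rename (Sum.inr : τ → σ ⊕ τ)))
    (fA : ∀ i, ↥(I ^ i) →ₗ[MvPolynomial σ k] M i) (hfA : ∀ i, Function.Surjective (fA i))
    (hfA0 : ∀ i u, fA i u = 0 ↔ (u : MvPolynomial σ k) ∈ I ^ (i + 1))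
    (fB : ∀ j, ↥(J ^ j) →ₗ[MvPolynomial τ k] N j) (hfB : ∀ j, Function.Surjective (fB j))
    (hfB0 : ∀ j v, fB j v = 0 ↔ (v : MvPolynomial τ k) ∈ J ^ (j + 1)) :
    Nonempty (subQuot k (Q ^ n) (Q ^ (n + 1)) ≃ₗ[MvPolynomial (σ ⊕ τ) k]
      ∀ i : Fin (n + 1), M i ⊗[k] N (n - i)) := by
  choose πA sA hA1 hA2 hA3 using fun i => exists_extension_and_section (fA i) (hfA i)
  choose πB sB hB1 hB2 hB3 using fun j => exists_extension_and_section (fB j) (hfB j)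
  have hA0 : ∀ {i i'}, i < i' → ∀ {u}, u ∈ I ^ i' → πA i u = 0 := fun hi u hu => by
    rw [hA1 _ u (Ideal.pow_le_pow_right hi.le hu), hfA0]
    exact Ideal.pow_le_pow_right hi hu
  have hB0 : ∀ {j j'}, j < j' → ∀ {v}, v ∈ J ^ j' → πB j v = 0 := fun hi v hv => by
    rw [hB1 _ v (Ideal.pow_le_pow_right hi.le hv), hfB0]
    exact Ideal.pow_le_pow_right hi hv
  have hAs : ∀ i a u, u ∈ I ^ i → πA i (a * u) = a • πA i u := fun i a u hu => by
    rw [hA1 i u hu, hA1 i _ (Ideal.mul_mem_left _ a hu), ← map_smul]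
    rfl
  have hBs : ∀ j b v, v ∈ J ^ j → πB j (b * v) = b • πB j v := fun j b v hv => by
    rw [hB1 j v hv, hB1 j _ (Ideal.mul_mem_left _ b hv), ← map_smul]
    rfl
  have hA4 : ∀ i u, u ∈ I ^ i → u - sA i (πA i u) ∈ I ^ (i + 1) := fun i u hu => by
    have hm := sub_mem hu (hA2 i (πA i u))
    refine (hfA0 i ⟨_, hm⟩).mp ?_
    rw [← hA1 i _ hm, map_sub, hA3, sub_self]
  have hB4 : ∀ j v, v ∈ J ^ j → v - sB j (πB j v) ∈ J ^ (j + 1) := fun j v hv => by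
    have hm := sub_mem hv (hB2 j (πB j v))
    refine (hfB0 j ⟨_, hm⟩).mp ?_
    rw [← hB1 j _ hm, map_sub, hB3, sub_self]
  let ψ (i j : ℕ) := TensorProduct.map (πA i) (πB j) ∘ₗ (sumToTensor k σ τ).toLinearMap
  have hψ : ∀ i j u v, ψ i j (rename Sum.inl u * rename Sum.inr v) = πA i u ⊗ₜ[k] πB j v := by
    intro i j u v
    simp [ψ, sumToTensor_rename_inl, sumToTensor_rename_inr]
  have hψ0 : ∀ {i j i' j'}, i < i' ∨ j < j' → ∀ {u v}, u ∈ I ^ i' → v ∈ J ^ j' →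
      ψ i j (rename Sum.inl u * rename Sum.inr v) = 0 := by
    intro i j i' j' h u v hu hv
    rw [hψ]
    rcases h with h | h
    · rw [hA0 h hu, zero_tmul]
    · rw [hB0 h hv, tmul_zero]
  have hl : ∀ {i j}, i + j = n → ∀ a f, f ∈ Q ^ n →
      ψ i j (rename Sum.inl a * f) = rename (Sum.inl : σ → σ ⊕ τ) a • ψ i j f := by
    intro i j hij a f hf
    rw [hQ] at hf
    refine sum_pow_induction (P := fun f => ψ i j (rename Sum.inl a * f) =
      rename (Sum.inl : σ → σ ⊕ τ) a • ψ i j f) (by simp) (fun f g hf hg => ?_)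
      (fun i' j' hij' u hu v hv => ?_) hf
    · rw [mul_add, map_add, hf, hg, map_add, smul_add]
    · rw [← mul_assoc, ← map_mul]
      by_cases h : i < i' ∨ j < j'
      · rw [hψ0 h (Ideal.mul_mem_left _ a hu) hv, hψ0 h hu hv, smul_zero]
      · obtain rfl : i' = i := by omega
        rw [hψ, hψ, hAs _ _ _ hu, rename_inl_smul_tmul]
  have hr : ∀ {i j}, i + j = n → ∀ b f, f ∈ Q ^ n →
      ψ i j (rename Sum.inr b * f) = rename (Sum.inr : τ → σ ⊕ τ) b • ψ i j f := by
    intro i j hij b f hf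
    rw [hQ] at hf
    refine sum_pow_induction (P := fun f => ψ i j (rename Sum.inr b * f) =
      rename (Sum.inr : τ → σ ⊕ τ) b • ψ i j f) (by simp) (fun f g hf hg => ?_)
      (fun i' j' hij' u hu v hv => ?_) hf
    · rw [mul_add, map_add, hf, hg, map_add, smul_add]
    · rw [mul_left_comm, ← map_mul]
      by_cases h : i < i' ∨ j < j'
      · rw [hψ0 h hu (Ideal.mul_mem_left _ b hv), hψ0 h hu hv, smul_zero]
      · obtain rfl : j' = j := by omega
        rw [hψ, hψ, hBs _ _ _ hv, rename_inr_smul_tmul]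
  have hker : ∀ {i j}, i + j = n → ∀ f ∈ Q ^ (n + 1), ψ i j f = 0 := by
    intro i j hij f hf
    rw [hQ] at hf
    refine sum_pow_induction (P := fun f => ψ i j f = 0) (map_zero _) (fun f g hf hg => ?_)
      (fun i' j' hij' u hu v hv => ?_) hf
    · rw [map_add, hf, hg, add_zero]
    · exact hψ0 (by omega) hu hv
  have hmem : ∀ {i j n}, i + j = n → ∀ {u v}, u ∈ I ^ i → v ∈ J ^ j →
      rename Sum.inl u * rename Sum.inr v ∈ Q ^ n := by
    rintro i j _ rfl u v hu hv
    rw [pow_add]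
    refine Ideal.mul_mem_mul ?_ ?_
    · refine Ideal.pow_right_mono (le_sup_left.trans_eq hQ.symm) i ?_
      rw [← Ideal.map_pow]
      exact Ideal.mem_map_of_mem _ hu
    · refine Ideal.pow_right_mono (le_sup_right.trans_eq hQ.symm) j ?_
      rw [← Ideal.map_pow]
      exact Ideal.mem_map_of_mem _ hv
  let ρ (i : Fin (n + 1)) : ↥(Q ^ n) →ₗ[MvPolynomial (σ ⊕ τ) k] M i ⊗[k] N (n - i) :=
    { toFun := fun f => ψ i (n - i) f
      map_add' := fun f g => map_add _ _ _
      map_smul' := map_smul_of_map_rename_smul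
        ((ψ i (n - i)).toAddMonoidHom.comp (Q ^ n).subtype.toAddMonoidHom)
        (fun a f => hl (by omega) a f f.2) (fun b f => hr (by omega) b f f.2) }
  let Θ := LinearMap.pi fun i => Submodule.liftQ (Submodule.comap (Q ^ n).subtype (Q ^ (n + 1)))
    (ρ i) (fun f hf => hker (by omega) f hf)
  have hΘ : ∀ f (hf : f ∈ Q ^ n) i, Θ (Submodule.Quotient.mk ⟨f, hf⟩) i = ψ i (n - i) f :=
    fun f hf i => rfl
  refine ⟨LinearEquiv.ofBijective Θ ⟨?_, ?_⟩⟩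
  · let κ (i j : ℕ) : M i ⊗[k] N j →ₗ[k] MvPolynomial (σ ⊕ τ) k :=
      LinearMap.mul' k _ ∘ₗ TensorProduct.map ((rename Sum.inl).toLinearMap ∘ₗ sA i)
        ((rename Sum.inr).toLinearMap ∘ₗ sB j)
    have hκ : ∀ f ∈ Q ^ n, f - ∑ i : Fin (n + 1), κ i (n - i) (ψ i (n - i) f) ∈ Q ^ (n + 1) := by
      intro f hf
      rw [hQ] at hf
      refine sum_pow_induction (P := fun f =>
        f - ∑ i : Fin (n + 1), κ i (n - i) (ψ i (n - i) f) ∈ Q ^ (n + 1)) (by simp)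
        (fun f g hf hg => ?_) (fun i j hij u hu v hv => ?_) hf
      · simp only [map_add, Finset.sum_add_distrib, add_sub_add_comm]
        exact add_mem hf hg
      · obtain rfl : j = n - i := by omega
        rw [Finset.sum_eq_single (⟨i, by omega⟩ : Fin (n + 1))]
        · simp only [hψ, κ, LinearMap.comp_apply, TensorProduct.map_tmul, LinearMap.mul'_apply,
            AlgHom.toLinearMap_apply]
          have : ∀ a b c d : MvPolynomial (σ ⊕ τ) k,
            a * b - c * d = (a - c) * b + c * (b - d) := fun a b c d => by ring
          rw [this, ← map_sub, ← map_sub]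
          exact add_mem (hmem (by omega) (hA4 _ _ hu) hv)
            (hmem (by omega) (hA2 _ _) (hB4 _ _ hv))
        · intro i' _ hne
          have : (i' : ℕ) ≠ i := fun h => hne (Fin.ext h)
          rw [hψ0 (by omega) hu hv, map_zero]
        · simp
    rw [← LinearMap.ker_eq_bot, LinearMap.ker_eq_bot']
    intro x hx
    obtain ⟨⟨f, hf⟩, rfl⟩ := Submodule.Quotient.mk_surjective _ x
    have h0 : ∀ i : Fin (n + 1), ψ i (n - i) f = 0 := fun i =>
      (hΘ f hf i).symm.trans (congrFun hx i)
    have := hκ f hf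
    simp only [h0, map_zero, Finset.sum_const_zero, sub_zero] at this
    exact (Submodule.Quotient.mk_eq_zero _).mpr this
  · have hsingle : ∀ (i : Fin (n + 1)) (t : M i ⊗[k] N (n - i)),
        Pi.single i t ∈ LinearMap.range Θ := by
      intro i t
      induction t with
      | zero => simp
      | add x y hx hy => rw [Pi.single_add]; exact add_mem hx hy
      | tmul x y =>
        obtain ⟨⟨u, hu⟩, rfl⟩ := hfA _ x
        obtain ⟨⟨v, hv⟩, rfl⟩ := hfB _ y
        refine ⟨Submodule.Quotient.mk ⟨_, hmem (by omega) hu hv⟩, funext fun i' => ?_⟩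
        rw [hΘ]
        by_cases h : i' = i
        · subst h
          rw [Pi.single_eq_same, hψ, hA1 _ _ hu, hB1 _ _ hv]
        · have : (i' : ℕ) ≠ i := fun h' => h (Fin.ext h')
          rw [Pi.single_eq_of_ne h, hψ0 (by omega) hu hv]
    intro y
    rw [← LinearMap.mem_range, ← Finset.univ_sum_single y]
    exact sum_mem fun i _ => hsingle i (y i)

end SumPow

section Main

open PaperHTT

variable {k σ τ : Type} [Field k]

lemma maxHomIdeal_eq_ker : maxHomIdeal k σ = RingHom.ker (constantCoeff (R := k) (σ := σ)) := by
  ext p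
  rw [maxHomIdeal, ← Set.image_univ, mem_ideal_span_X_image, RingHom.mem_ker, constantCoeff_eq]
  refine ⟨fun h => ?_, fun h m hm => ?_⟩
  · by_contra h0
    obtain ⟨i, _, hi⟩ := h 0 (mem_support_iff.mpr h0)
    exact hi rfl
  · by_contra! h1
    have : m = 0 := Finsupp.ext fun i => h1 i (Set.mem_univ i)
    exact mem_support_iff.mp hm (this ▸ h)

lemma maxHomIdeal_ne_top : maxHomIdeal k σ ≠ ⊤ := by
  rw [maxHomIdeal_eq_ker]
  exact RingHom.ker_ne_top _

lemma PaperHTT.IsHomogeneousIdeal.le_maxHomIdeal {I : Ideal (MvPolynomial σ k)}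
    (hI : IsHomogeneousIdeal k I) (hI' : I ≠ ⊤) : I ≤ maxHomIdeal k σ := by
  intro f hf
  rw [maxHomIdeal_eq_ker, RingHom.mem_ker, constantCoeff_eq]
  by_contra h0
  have := hI f hf 0
  rw [homogeneousComponent_zero] at this
  exact hI' (Ideal.eq_top_of_isUnit_mem _ this ((isUnit_iff_ne_zero.mpr h0).map C))

lemma exists_hasDepth_subQuot_pow [Finite σ] {I : Ideal (MvPolynomial σ k)} (hI0 : I ≠ ⊥)
    (hI : IsHomogeneousIdeal k I) (hI' : I ≠ ⊤) (i : ℕ) :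
    ∃ d, HasDepth (maxHomIdeal k σ) (subQuot k (I ^ i) (I ^ (i + 1))) d :=
  exists_hasDepth _ _
    (smul_top_ne_top_of_subQuot maxHomIdeal_ne_top (hI.le_maxHomIdeal hI') hI0 i)

lemma HasDepth.depthSubQuot_eq {p q : Ideal (MvPolynomial σ k)} {d : ℕ}
    (h : HasDepth (maxHomIdeal k σ) (subQuot k p q) d) : depthSubQuot k p q = d :=
  h.extDepth.sInf_eq

section Abstract

open CategoryTheory in
lemma extDepth_of_linearEquiv_pi {R : Type} [CommRing R] {𝔪 : Ideal R} {ι : Type} [Fintype ι]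
    {M : Type} [AddCommGroup M] [Module R M] {T : ι → Type} [∀ i, AddCommGroup (T i)]
    [∀ i, Module R (T i)] (e : M ≃ₗ[R] ∀ i, T i) {d : ι → ℕ}
    (h : ∀ i, ExtDepth 𝔪 (ModuleCat.of R (T i)) (d i)) (i₀ : ι) (hi₀ : ∀ i, d i₀ ≤ d i) :
    ExtDepth 𝔪 (ModuleCat.of R M) (d i₀) := by
  classical
  refine extDepth_of_sum_eq_id
    (fun i => ModuleCat.ofHom (e.symm.toLinearMap ∘ₗ LinearMap.single R T i))
    (fun i => ModuleCat.ofHom (LinearMap.proj i ∘ₗ e.toLinearMap))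
    (fun i => ?_) ?_ h i₀ hi₀
  · ext1
    refine LinearMap.ext fun x => ?_
    simp
  · ext1
    refine LinearMap.ext fun x => e.injective ?_
    simp [ModuleCat.hom_sum, map_sum, Finset.univ_sum_single]

open TensorProduct

attribute [local instance] externalTensorModule

variable {M : ℕ → Type} [∀ i, AddCommGroup (M i)] [∀ i, Module (MvPolynomial σ k) (M i)]
  [∀ i, Module k (M i)] [∀ i, IsScalarTower k (MvPolynomial σ k) (M i)]
  {N : ℕ → Type} [∀ j, AddCommGroup (N j)] [∀ j, Module (MvPolynomial τ k) (N j)]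
  [∀ j, Module k (N j)] [∀ j, IsScalarTower k (MvPolynomial τ k) (N j)]

theorem depthSubQuot_sum_pow_eq {I : Ideal (MvPolynomial σ k)}
    {J : Ideal (MvPolynomial τ k)} (n : ℕ) {Q : Ideal (MvPolynomial (σ ⊕ τ) k)}
    (hQ : Q = I.map (rename (Sum.inl : σ → σ ⊕ τ)) + J.map (rename (Sum.inr : τ → σ ⊕ τ)))
    (fA : ∀ i, ↥(I ^ i) →ₗ[MvPolynomial σ k] M i) (hfA : ∀ i, Function.Surjective (fA i))
    (hfA0 : ∀ i u, fA i u = 0 ↔ (u : MvPolynomial σ k) ∈ I ^ (i + 1))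
    (fB : ∀ j, ↥(J ^ j) →ₗ[MvPolynomial τ k] N j) (hfB : ∀ j, Function.Surjective (fB j))
    (hfB0 : ∀ j v, fB j v = 0 ↔ (v : MvPolynomial τ k) ∈ J ^ (j + 1)) {a b : ℕ → ℕ}
    (ha : ∀ i, HasDepth (maxHomIdeal k σ) (M i) (a i))
    (hb : ∀ j, HasDepth (maxHomIdeal k τ) (N j) (b j)) :
    depthSubQuot k (Q ^ n) (Q ^ (n + 1)) = sInf {v | ∃ i j, i + j = n ∧ v = a i + b j} := by
  obtain ⟨e⟩ := nonempty_linearEquiv_subQuot_sum_pow n hQ fA hfA hfA0 fB hfB hfB0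
  obtain ⟨i₀, hi₀⟩ := Finite.exists_min fun i : Fin (n + 1) => a i + b (n - i)
  have h := extDepth_of_linearEquiv_pi e (fun i => ((ha i).tensor (hb (n - i))).extDepth) i₀ hi₀
  refine h.sInf_eq.trans (le_antisymm (le_csInf ⟨_, 0, n, zero_add n, rfl⟩ ?_)
    (Nat.sInf_le ⟨i₀, n - i₀, by omega, rfl⟩))
  rintro _ ⟨i, j, rfl, rfl⟩
  simpa using hi₀ ⟨i, by omega⟩

end Abstract

theorem depthSubQuot_sum_pow_eq_of_isHomogeneousIdeal [Finite σ] [Finite τ]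
    {I : Ideal (MvPolynomial σ k)} {J : Ideal (MvPolynomial τ k)} (n : ℕ)
    (hI0 : I ≠ ⊥) (hI : IsHomogeneousIdeal k I) (hI' : I ≠ ⊤)
    (hJ0 : J ≠ ⊥) (hJ : IsHomogeneousIdeal k J) (hJ' : J ≠ ⊤)
    {Q : Ideal (MvPolynomial (σ ⊕ τ) k)}
    (hQ : Q = I.map (rename (Sum.inl : σ → σ ⊕ τ)) + J.map (rename (Sum.inr : τ → σ ⊕ τ))) :
    depthSubQuot k (Q ^ n) (Q ^ (n + 1)) = sInf {v | ∃ i j, i + j = n ∧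
      v = depthSubQuot k (I ^ i) (I ^ (i + 1)) + depthSubQuot k (J ^ j) (J ^ (j + 1))} := by
  choose a ha using exists_hasDepth_subQuot_pow hI0 hI hI'
  choose b hb using exists_hasDepth_subQuot_pow hJ0 hJ hJ'
  simp only [(ha _).depthSubQuot_eq, (hb _).depthSubQuot_eq]
  exact depthSubQuot_sum_pow_eq n hQ
    (fun i => Submodule.mkQ (Submodule.comap (I ^ i).subtype (I ^ (i + 1))))
    (fun i => Submodule.mkQ_surjective _) (fun i u => Submodule.Quotient.mk_eq_zero _)
    (fun j => Submodule.mkQ (Submodule.comap (J ^ j).subtype (J ^ (j + 1))))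
    (fun j => Submodule.mkQ_surjective _) (fun j v => Submodule.Quotient.mk_eq_zero _) ha hb

end Main

open PaperHTT in
/-- Theorem 3.3(i): for `n ≥ 1`,
`depth (I+J)^n/(I+J)^(n+1) = min_(i+j=n) (depth I^i/I^(i+1) + depth J^j/J^(j+1))`. -/
theorem depth_successive_quot_eq
    (k : Type) [Field k] (r s : ℕ)
    (I : Ideal (PA k r)) (J : Ideal (PB k s))
    (hI0 : I ≠ ⊥) (hI1 : I ≠ ⊤) (hIh : IsHomogeneousIdeal k I)
    (hJ0 : J ≠ ⊥) (hJ1 : J ≠ ⊤) (hJh : IsHomogeneousIdeal k J)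
    (n : ℕ) (hn : 1 ≤ n) :
    depthSubQuot k ((sumIJ k I J) ^ n) ((sumIJ k I J) ^ (n + 1)) =
      sInf {v : ℕ | ∃ i j : ℕ, i + j = n ∧
        v = depthSubQuot k (I ^ i) (I ^ (i + 1)) + depthSubQuot k (J ^ j) (J ^ (j + 1))} := by
  exact depthSubQuot_sum_pow_eq_of_isHomogeneousIdeal n hI0 hIh hI1 hJ0 hJh hJ1 rfl
end
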